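/- For every binary pattern P, the class Av(P) of all binary matrices avoiding P as an interval minor is row-bounded if and only if P contains none of Q₁, Q₂, Q₃, Q₄ as an interval minor. -/

import Mathlib

/-!
Common framework: binary matrices, interval minors, criticality, 0-runs,
row/column complexity, embeddings and related notions, following
Jelínek–Kučera, "On the structure of matrices avoiding interval-minor
patterns". All indices are 0-based.
-/

/-- A binary matrix: dimensions `m × n`, with entries given by a total
function (entries outside the range `[0,m) × [0,n)` are irrelevant:
all definitions below only inspect in-range entries). -/
structure BMat where
  m : ℕ
  n : ℕ
  entry : ℕ → ℕ → Bool

namespace BMat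

/-- The support of a binary matrix: its set of (in-range) 1-entries. -/
def supp (M : BMat) : Set (ℕ × ℕ) :=
  {p | p.1 < M.m ∧ p.2 < M.n ∧ M.entry p.1 p.2 = true}

/-- `M'` is obtained from `M` by contracting two adjacent rows `r`, `r+1`. -/
def RowCon (M M' : BMat) : Prop :=
  ∃ r, r + 1 < M.m ∧ M'.m + 1 = M.m ∧ M'.n = M.n ∧
    ∀ i j, i < M'.m → j < M'.n →
      M'.entry i j =
        if i < r then M.entry i j
        else if i = r then (M.entry r j || M.entry (r + 1) j)
        else M.entry (i + 1) j

/-- `M'` is obtained from `M` by contracting two adjacent columns `c`, `c+1`. -/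
def ColCon (M M' : BMat) : Prop :=
  ∃ c, c + 1 < M.n ∧ M'.n + 1 = M.n ∧ M'.m = M.m ∧
    ∀ i j, i < M'.m → j < M'.n →
      M'.entry i j =
        if j < c then M.entry i j
        else if j = c then (M.entry i c || M.entry i (c + 1))
        else M.entry i (j + 1)

/-- One contraction step (of a row or of a column). -/
def Con (M M' : BMat) : Prop := RowCon M M' ∨ ColCon M M'

/-- `P` is an interval minor of `M`: `M` can be transformed by a sequence of
row and column contractions into a matrix of the same dimensions as `P`
dominating `P`. -/
def IntervalMinor (P M : BMat) : Prop :=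
  ∃ M', Relation.ReflTransGen Con M M' ∧ M'.m = P.m ∧ M'.n = P.n ∧
    ∀ i j, i < P.m → j < P.n → P.entry i j = true → M'.entry i j = true

/-- `M` avoids `P` as an interval minor. -/
def Avoids (P M : BMat) : Prop := ¬ IntervalMinor P M

/-- The class of all matrices avoiding `P` as an interval minor. -/
def Av (P : BMat) : Set BMat := {M | Avoids P M}

/-- The class of all matrices avoiding every pattern of `F` as an interval
minor. -/
def AvF (F : Set BMat) : Set BMat := {M | ∀ P ∈ F, Avoids P M}

/-- The matrix obtained from `M` by changing the entry at position `(i, j)`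
into a 1-entry. -/
def setOne (M : BMat) (i j : ℕ) : BMat :=
  ⟨M.m, M.n, fun a b => if a = i ∧ b = j then true else M.entry a b⟩

/-- `M` is critical for the class `C`: it lies in `C`, but changing any
single 0-entry of `M` into a 1-entry leaves `C`. -/
def CriticalFor (C : Set BMat) (M : BMat) : Prop :=
  M ∈ C ∧ ∀ i j, i < M.m → j < M.n → M.entry i j = false → setOne M i j ∉ C

/-- The number of horizontal 0-runs in row `r` of `M`, counted via their
starting columns. -/
noncomputable def rowRunCount (M : BMat) (r : ℕ) : ℕ :=
  Set.ncard {j | j < M.n ∧ M.entry r j = false ∧ (j = 0 ∨ M.entry r (j - 1) = true)}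

/-- The number of vertical 0-runs in column `c` of `M`. -/
noncomputable def colRunCount (M : BMat) (c : ℕ) : ℕ :=
  Set.ncard {i | i < M.m ∧ M.entry i c = false ∧ (i = 0 ∨ M.entry (i - 1) c = true)}

/-- A class is row-bounded if there is a uniform bound on the number of
0-runs in any row of any matrix that is critical for the class. -/
def RowBounded (C : Set BMat) : Prop :=
  ∃ K, ∀ M, CriticalFor C M → ∀ r, r < M.m → rowRunCount M r ≤ K

/-- A class is column-bounded if there is a uniform bound on the number of
0-runs in any column of any matrix that is critical for the class. -/
def ColBounded (C : Set BMat) : Prop :=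
  ∃ K, ∀ M, CriticalFor C M → ∀ c, c < M.n → colRunCount M c ≤ K

/-- A class is bounded if it is both row-bounded and column-bounded. -/
def Bounded (C : Set BMat) : Prop := RowBounded C ∧ ColBounded C

/-- The pattern `Q₁`, with support `{(1,2),(2,1),(3,3)}` (1-based). -/
def Q1 : BMat :=
  ⟨3, 3, fun i j => (i == 0 && j == 1) || (i == 1 && j == 0) || (i == 2 && j == 2)⟩

/-- The pattern `Q₂`, with support `{(1,2),(2,3),(3,1)}` (1-based). -/
def Q2 : BMat :=
  ⟨3, 3, fun i j => (i == 0 && j == 1) || (i == 1 && j == 2) || (i == 2 && j == 0)⟩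

/-- The pattern `Q₃`, with support `{(1,1),(2,3),(3,2)}` (1-based). -/
def Q3 : BMat :=
  ⟨3, 3, fun i j => (i == 0 && j == 0) || (i == 1 && j == 2) || (i == 2 && j == 1)⟩

/-- The pattern `Q₄`, with support `{(1,3),(2,1),(3,2)}` (1-based). -/
def Q4 : BMat :=
  ⟨3, 3, fun i j => (i == 0 && j == 2) || (i == 1 && j == 0) || (i == 2 && j == 1)⟩

/-- The diagonal pattern `D_k`, with support `{(i,i) : i ∈ [k]}`. -/
def D (k : ℕ) : BMat := ⟨k, k, fun i j => i == j⟩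

/-- The antidiagonal pattern `D̄_k`, with support `{(i, k+1-i) : i ∈ [k]}`
(1-based). -/
def Dbar (k : ℕ) : BMat := ⟨k, k, fun i j => i + j + 1 == k⟩

/-- An embedding of `P` into `M`: 1-entries go to 1-entries, and the map is
strictly monotone in rows and in columns. -/
def IsEmbedding (P M : BMat) (φ : ℕ → ℕ → ℕ × ℕ) : Prop :=
  (∀ i j, i < P.m → j < P.n → (φ i j).1 < M.m ∧ (φ i j).2 < M.n) ∧
  (∀ i j, i < P.m → j < P.n → P.entry i j = true →
      M.entry (φ i j).1 (φ i j).2 = true) ∧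
  (∀ i₁ j₁ i₂ j₂, i₁ < P.m → j₁ < P.n → i₂ < P.m → j₂ < P.n →
      (i₁ < i₂ → (φ i₁ j₁).1 < (φ i₂ j₂).1) ∧
      (j₁ < j₂ → (φ i₁ j₁).2 < (φ i₂ j₂).2))

/-- A partition of `M` containing `P` (via row indices `r 0 < ⋯ < r P.m ≤ M.m`
and column indices `c 0 < ⋯ < c P.n ≤ M.n`). -/
def PartitionContains (M P : BMat) : Prop :=
  ∃ r c : ℕ → ℕ,
    (∀ i, i < P.m → r i < r (i + 1)) ∧ (∀ j, j < P.n → c j < c (j + 1)) ∧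
    r P.m ≤ M.m ∧ c P.n ≤ M.n ∧
    ∀ i j, i < P.m → j < P.n → P.entry i j = true →
      ∃ a b, r i ≤ a ∧ a < r (i + 1) ∧ c j ≤ b ∧ b < c (j + 1) ∧
        M.entry a b = true

/-- A partial embedding of `P` into `M`, defined on a nonempty set `S` of
entries of `P`. -/
def IsPartialEmbedding (P M : BMat) (S : Set (ℕ × ℕ)) (ψ : ℕ × ℕ → ℕ × ℕ) : Prop :=
  S.Nonempty ∧ (∀ e ∈ S, e.1 < P.m ∧ e.2 < P.n) ∧
  (∀ i j, i < P.m → j < P.n → P.entry i j = true →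
      (i, j) ∈ S ∧ M.entry (ψ (i, j)).1 (ψ (i, j)).2 = true) ∧
  (∀ e ∈ S, (ψ e).1 < M.m ∧ (ψ e).2 < M.n ∧
      e.1 ≤ (ψ e).1 ∧ e.2 ≤ (ψ e).2 ∧
      P.m - 1 - e.1 ≤ M.m - 1 - (ψ e).1 ∧ P.n - 1 - e.2 ≤ M.n - 1 - (ψ e).2) ∧
  (∀ e₁ ∈ S, ∀ e₂ ∈ S,
      (e₁.1 < e₂.1 → e₂.1 - e₁.1 ≤ (ψ e₂).1 - (ψ e₁).1) ∧
      (e₁.2 < e₂.2 → e₂.2 - e₁.2 ≤ (ψ e₂).2 - (ψ e₁).2))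

/-- A horizontal 0-run of `M` in row `r`, occupying exactly columns
`c₁, …, c₂`. -/
def ZeroRun (M : BMat) (r c₁ c₂ : ℕ) : Prop :=
  r < M.m ∧ c₁ ≤ c₂ ∧ c₂ < M.n ∧
  (∀ j, c₁ ≤ j → j ≤ c₂ → M.entry r j = false) ∧
  (c₁ = 0 ∨ M.entry r (c₁ - 1) = true) ∧
  (c₂ + 1 = M.n ∨ M.entry r (c₂ + 1) = true)

/-- The 0-entry `f` of `M` is critical for the 1-entry `e` of `P`: some
embedding of `P` into `M △ f` maps `e` to `f`. -/
def CritEntry (P : BMat) (e : ℕ × ℕ) (M : BMat) (f : ℕ × ℕ) : Prop :=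
  f.1 < M.m ∧ f.2 < M.n ∧ M.entry f.1 f.2 = false ∧
  ∃ φ, IsEmbedding P (setOne M f.1 f.2) φ ∧ φ e.1 e.2 = f

/-- The number of horizontal 0-runs in row `r` of `M` that are critical for
the 1-entry `e` of `P` (counted via their starting columns). -/
noncomputable def critRunCount (P : BMat) (e : ℕ × ℕ) (M : BMat) (r : ℕ) : ℕ :=
  Set.ncard {c₁ | ∃ c₂, ZeroRun M r c₁ c₂ ∧
    ∃ c, c₁ ≤ c ∧ c ≤ c₂ ∧ CritEntry P e M (r, c)}

/-- The 1-entry `e` of `P` is row-bounding: every row of every `P`-avoiding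
matrix contains a bounded number of 0-runs critical for `e`. -/
def EntryRowBounding (P : BMat) (e : ℕ × ℕ) : Prop :=
  ∃ K, ∀ M, Avoids P M → ∀ r, critRunCount P e M r ≤ K

/-- An increasing walk from `e` to `e'`: a sequence of positions, each step
moving one column to the right or one row up, with `W` its set of
positions. -/
def IsIncreasingWalk (W : Set (ℕ × ℕ)) (e e' : ℕ × ℕ) : Prop :=
  ∃ (t : ℕ) (f : ℕ → ℕ × ℕ), f 0 = e ∧ f t = e' ∧
    W = {x | ∃ i, i ≤ t ∧ f i = x} ∧
    ∀ i, i < t →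
      ((f (i + 1)).1 = (f i).1 ∧ (f (i + 1)).2 = (f i).2 + 1) ∨
      ((f (i + 1)).1 + 1 = (f i).1 ∧ (f (i + 1)).2 = (f i).2)

/-- All 1-entries of `P` can be covered by at most `k` lines
(rows or columns). -/
def CoveredByLines (P : BMat) (k : ℕ) : Prop :=
  ∃ (R C : Finset ℕ), R.card + C.card ≤ k ∧
    ∀ i j, i < P.m → j < P.n → P.entry i j = true → i ∈ R ∨ j ∈ C

/-- Clockwise rotation by 90 degrees. -/
def rot90 (P : BMat) : BMat := ⟨P.n, P.m, fun i j => P.entry (P.m - 1 - j) i⟩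

/-- Rotation by 180 degrees. -/
def rot180 (P : BMat) : BMat :=
  ⟨P.m, P.n, fun i j => P.entry (P.m - 1 - i) (P.n - 1 - j)⟩

/-- Clockwise rotation by 270 degrees. -/
def rot270 (P : BMat) : BMat := ⟨P.n, P.m, fun i j => P.entry j (P.n - 1 - i)⟩

/-- Reflection turning the matrix upside down (reversing the rows). -/
def reflRows (P : BMat) : BMat := ⟨P.m, P.n, fun i j => P.entry (P.m - 1 - i) j⟩

/-- Reflection reversing the columns. -/
def reflCols (P : BMat) : BMat := ⟨P.m, P.n, fun i j => P.entry i (P.n - 1 - j)⟩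

/-- Reflection along the main diagonal (transposition). -/
def transposeB (P : BMat) : BMat := ⟨P.n, P.m, fun i j => P.entry j i⟩

/-- Reflection along the antidiagonal. -/
def antitransposeB (P : BMat) : BMat :=
  ⟨P.n, P.m, fun i j => P.entry (P.m - 1 - j) (P.n - 1 - i)⟩

/-- Type 1 pattern of Lemma `lem-2types`: rows `r < r' < r''`, columns
`c < c'`, with `supp ⊆ ({r'} × [c,c']) ∪ {(r,c),(r'',c),(r,c'),(r'',c')}`. -/
def TypeOne (P₀ : BMat) : Prop :=
  ∃ r r' r'' c c', r < r' ∧ r' < r'' ∧ r'' < P₀.m ∧ c < c' ∧ c' < P₀.n ∧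
    ∀ i j, i < P₀.m → j < P₀.n → P₀.entry i j = true →
      (i = r' ∧ c ≤ j ∧ j ≤ c') ∨ ((i = r ∨ i = r'') ∧ (j = c ∨ j = c'))

/-- Type 2 pattern of Lemma `lem-2types`: rows `r < r'`, columns `c < c'`,
with `supp ⊆ ({r} × [c,c']) ∪ ({r'} × [1,c]) ∪ ([1,r] × {c'}) ∪ {(r',c')}`. -/
def TypeTwo (P₀ : BMat) : Prop :=
  ∃ r r' c c', r < r' ∧ r' < P₀.m ∧ c < c' ∧ c' < P₀.n ∧
    ∀ i j, i < P₀.m → j < P₀.n → P₀.entry i j = true →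
      (i = r ∧ c ≤ j ∧ j ≤ c') ∨ (i = r' ∧ j ≤ c) ∨ (i ≤ r ∧ j = c') ∨
      (i = r' ∧ j = c')

/-- A minor-closed class of binary matrices. -/
def MinorClosed (C : Set BMat) : Prop :=
  ∀ M ∈ C, ∀ P, IntervalMinor P M → P ∈ C

/-- The 4×3 pattern with support `{(1,2),(2,1),(3,2),(4,3)}` (1-based), from
Proposition `pro-counter`. -/
def P18 : BMat :=
  ⟨4, 3, fun i j => (i == 0 && j == 1) || (i == 1 && j == 0) ||
    (i == 2 && j == 1) || (i == 3 && j == 2)⟩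

end BMat

open BMat


namespace IM

lemma strict_le {R : ℕ → ℕ} {k : ℕ} (h : ∀ i, i < k → R i < R (i+1)) :
    ∀ a b, a ≤ b → b ≤ k → R a + (b - a) ≤ R b := by
  intro a b hab
  induction b, hab using Nat.le_induction with
  | base => intro _; simp
  | succ n hn ih =>
    intro hk
    have := ih (by omega)
    have := h n (by omega)
    omega

lemma con_pc {M M1 P : BMat} (h : Con M M1) (hp : PartitionContains M1 P) :
    PartitionContains M P := by
  obtain ⟨R, C, hR, hC, hRm, hCn, hE⟩ := hp
  rcases h with ⟨r, hr, hm, hn, he⟩ | ⟨r, hr, hn, hm, he⟩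
  · refine ⟨fun x => if R x ≤ r then R x else R x + 1, C, ?_, hC, ?_, by omega, ?_⟩
    · intro i hi; have := hR i hi; (try dsimp only); split_ifs <;> omega
    · (try dsimp only); split_ifs <;> omega
    · intro i j hi hj hP
      obtain ⟨a, b, h1, h2, h3, h4, h5⟩ := hE i j hi hj hP
      have hRi := strict_le hR (i+1) P.m (by omega) le_rfl
      have hCi := strict_le hC (j+1) P.n (by omega) le_rfl
      rw [he a b (by omega) (by omega)] at h5
      split_ifs at h5 with q1 q2
      · exact ⟨a, b, by (try dsimp only); split_ifs <;> omega, by (try dsimp only); split_ifs <;> omega, h3, h4, h5⟩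
      · subst q2
        rcases Bool.or_eq_true _ _ |>.mp h5 with h5 | h5
        · exact ⟨a, b, by (try dsimp only); split_ifs <;> omega, by (try dsimp only); split_ifs <;> omega, h3, h4, h5⟩
        · exact ⟨a+1, b, by (try dsimp only); split_ifs <;> omega, by (try dsimp only); split_ifs <;> omega, h3, h4, h5⟩
      · exact ⟨a+1, b, by (try dsimp only); split_ifs <;> omega, by (try dsimp only); split_ifs <;> omega, h3, h4, h5⟩
  · refine ⟨R, fun x => if C x ≤ r then C x else C x + 1, hR, ?_, by omega, ?_, ?_⟩
    · intro i hi; have := hC i hi; (try dsimp only); split_ifs <;> omega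
    · (try dsimp only); split_ifs <;> omega
    · intro i j hi hj hP
      obtain ⟨a, b, h1, h2, h3, h4, h5⟩ := hE i j hi hj hP
      have hRi := strict_le hR (i+1) P.m (by omega) le_rfl
      have hCi := strict_le hC (j+1) P.n (by omega) le_rfl
      rw [he a b (by omega) (by omega)] at h5
      split_ifs at h5 with q1 q2
      · exact ⟨a, b, h1, h2, by (try dsimp only); split_ifs <;> omega, by (try dsimp only); split_ifs <;> omega, h5⟩
      · subst q2
        rcases Bool.or_eq_true _ _ |>.mp h5 with h5 | h5
        · exact ⟨a, b, h1, h2, by (try dsimp only); split_ifs <;> omega, by (try dsimp only); split_ifs <;> omega, h5⟩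
        · exact ⟨a, b+1, h1, h2, by (try dsimp only); split_ifs <;> omega, by (try dsimp only); split_ifs <;> omega, h5⟩
      · exact ⟨a, b+1, h1, h2, by (try dsimp only); split_ifs <;> omega, by (try dsimp only); split_ifs <;> omega, h5⟩

lemma im_pc {P M : BMat} (h : IntervalMinor P M) : PartitionContains M P := by
  obtain ⟨M', h, hm, hn, he⟩ := h
  induction h using Relation.ReflTransGen.head_induction_on with
  | refl =>
    refine ⟨id, id, by simp, by simp, by simp [hm], by simp [hn], ?_⟩
    intro i j hi hj hP
    exact ⟨i, j, le_rfl, by simp, le_rfl, by simp, he i j hi hj hP⟩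
  | head h1 _ ih => exact con_pc h1 ih

lemma exists_gap {R : ℕ → ℕ} {k m : ℕ} (h0 : R 0 = 0) (hk : R k = m) (hlt : k < m) :
    ∃ i, i < k ∧ R i + 1 < R (i+1) := by
  by_contra hcon
  push Not at hcon
  have : ∀ b, b ≤ k → R b ≤ b := by
    intro b
    induction b with
    | zero => intro _; omega
    | succ n ih => intro hn; have := ih (by omega); have := hcon n (by omega); omega
  have := this k le_rfl
  omega

lemma pc_im_aux (P : BMat) (s : ℕ) : ∀ M : BMat, M.m + M.n = s → ∀ R C : ℕ → ℕ,
    R 0 = 0 → R P.m = M.m → C 0 = 0 → C P.n = M.n →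
    (∀ i, i < P.m → R i < R (i + 1)) → (∀ j, j < P.n → C j < C (j + 1)) →
    (∀ i j, i < P.m → j < P.n → P.entry i j = true →
      ∃ a b, R i ≤ a ∧ a < R (i + 1) ∧ C j ≤ b ∧ b < C (j + 1) ∧
        M.entry a b = true) → IntervalMinor P M := by
  induction s with
  | zero =>
    intro M hs R C hR0 hRm hC0 hCn hR hC hE
    have := strict_le hR 0 P.m (by omega) le_rfl
    have := strict_le hC 0 P.n (by omega) le_rfl
    refine ⟨M, .refl, by omega, by omega, fun i j hi hj => by omega⟩
  | succ s ih =>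
    intro M hs R C hR0 hRm hC0 hCn hR hC hE
    have hk1 := strict_le hR 0 P.m (by omega) le_rfl
    have hk2 := strict_le hC 0 P.n (by omega) le_rfl
    by_cases h1 : P.m < M.m
    · obtain ⟨k, hk, hgap⟩ := exists_gap hR0 hRm h1
      have hkm := strict_le hR (k+1) P.m (by omega) le_rfl
      let M1 : BMat := ⟨M.m - 1, M.n, fun i j => if i < R k then M.entry i j
        else if i = R k then (M.entry (R k) j || M.entry (R k + 1) j)
        else M.entry (i + 1) j⟩
      have hcon : Con M M1 := Or.inl ⟨R k, by omega, by simp [M1]; omega, rfl, fun i j _ _ => rfl⟩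
      have := ih M1 (by simp [M1]; omega) (fun x => if x ≤ k then R x else R x - 1) C (by simp [hR0])
        (by simp [M1, hRm]; omega) hC0 hCn ?_ hC ?_
      · obtain ⟨M', h, h2⟩ := this
        exact ⟨M', .head hcon h, h2⟩
      · intro i hi
        have := hR i hi
        have := strict_le hR k (i+1)
        (try dsimp only); split_ifs
        · omega
        · have : i = k := by omega
          subst this; omega
        · omega
        · have := strict_le hR (k+1) i (by omega) (by omega); omega
      · intro i j hi hj hP
        obtain ⟨a, b, g1, g2, g3, g4, g5⟩ := hE i j hi hj hP
        rcases lt_trichotomy i k with hik | hik | hik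
        · have := strict_le hR (i+1) k (by omega) (by omega)
          refine ⟨a, b, by (try dsimp only); split_ifs <;> omega, by (try dsimp only); split_ifs <;> omega, g3, g4, ?_⟩
          simp only [M1]; rw [if_pos (by omega)]; exact g5
        · subst hik
          by_cases ha : a = R i
          · subst ha
            refine ⟨R i, b, by simp, by simp; omega, g3, g4, ?_⟩
            simp [M1, g5]
          · refine ⟨a - 1, b, by simp; omega, by simp; omega, g3, g4, ?_⟩
            simp only [M1]; rw [if_neg (by omega)]
            split_ifs with q
            · have : a = R i + 1 := by omega
              subst this; simp [g5]
            · rw [show a - 1 + 1 = a by omega]; exact g5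
        · have := strict_le hR (k+1) i (by omega) (by omega)
          refine ⟨a - 1, b, by (try dsimp only); split_ifs <;> omega, by (try dsimp only); split_ifs <;> omega, g3, g4, ?_⟩
          simp only [M1]; rw [if_neg (by omega)]
          split_ifs with q
          · omega
          · rw [show a - 1 + 1 = a by omega]; exact g5
    by_cases h2 : P.n < M.n
    · obtain ⟨k, hk, hgap⟩ := exists_gap hC0 hCn h2
      have hkm := strict_le hC (k+1) P.n (by omega) le_rfl
      let M1 : BMat := ⟨M.m, M.n - 1, fun i j => if j < C k then M.entry i j
        else if j = C k then (M.entry i (C k) || M.entry i (C k + 1))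
        else M.entry i (j + 1)⟩
      have hcon : Con M M1 := Or.inr ⟨C k, by omega, by simp [M1]; omega, rfl, fun i j _ _ => rfl⟩
      have := ih M1 (by simp [M1]; omega) R (fun x => if x ≤ k then C x else C x - 1) hR0 hRm (by simp [hC0])
        (by simp [M1, hCn]; omega) hR ?_ ?_
      · obtain ⟨M', h, h2⟩ := this
        exact ⟨M', .head hcon h, h2⟩
      · intro i hi
        have := hC i hi
        have := strict_le hC k (i+1)
        (try dsimp only); split_ifs
        · omega
        · have : i = k := by omega
          subst this; omega
        · omega
        · have := strict_le hC (k+1) i (by omega) (by omega); omega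
      · intro j i hj hi hP
        obtain ⟨b, a, g3, g4, g1, g2, g5⟩ := hE j i hj hi hP
        rcases lt_trichotomy i k with hik | hik | hik
        · have := strict_le hC (i+1) k (by omega) (by omega)
          refine ⟨b, a, g3, g4, by (try dsimp only); split_ifs <;> omega, by (try dsimp only); split_ifs <;> omega, ?_⟩
          simp only [M1]; rw [if_pos (by omega)]; exact g5
        · subst hik
          by_cases ha : a = C i
          · subst ha
            refine ⟨b, C i, g3, g4, by simp, by simp; omega, ?_⟩
            simp [M1, g5]
          · refine ⟨b, a - 1, g3, g4, by simp; omega, by simp; omega, ?_⟩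
            simp only [M1]; rw [if_neg (by omega)]
            split_ifs with q
            · have : a = C i + 1 := by omega
              subst this; simp [g5]
            · rw [show a - 1 + 1 = a by omega]; exact g5
        · have := strict_le hC (k+1) i (by omega) (by omega)
          refine ⟨b, a - 1, g3, g4, by (try dsimp only); split_ifs <;> omega, by (try dsimp only); split_ifs <;> omega, ?_⟩
          simp only [M1]; rw [if_neg (by omega)]
          split_ifs with q
          · omega
          · rw [show a - 1 + 1 = a by omega]; exact g5
    · refine ⟨M, .refl, by omega, by omega, fun i j hi hj hP => ?_⟩
      obtain ⟨a, b, g1, g2, g3, g4, g5⟩ := hE i j hi hj hP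
      have := strict_le hR 0 i (by omega) (by omega)
      have := strict_le hR (i+1) P.m (by omega) (by omega)
      have := strict_le hC 0 j (by omega) (by omega)
      have := strict_le hC (j+1) P.n (by omega) (by omega)
      have h1 : a = i := by omega
      have h2 : b = j := by omega
      rw [← h1, ← h2]; exact g5

lemma pc_im {P M : BMat} (hm : 0 < P.m) (hn : 0 < P.n) (h : PartitionContains M P) :
    IntervalMinor P M := by
  obtain ⟨R, C, hR, hC, hRm, hCn, hE⟩ := h
  refine pc_im_aux P _ M rfl (fun x => if x = 0 then 0 else if x = P.m then M.m else R x)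
    (fun x => if x = 0 then 0 else if x = P.n then M.n else C x) (by simp)
    (by simp; omega) (by simp) (by simp; omega) ?_ ?_ ?_
  · intro i hi
    have := hR i hi
    have := strict_le hR (i+1) P.m (by omega) le_rfl
    (try dsimp only); split_ifs <;> first | omega | (exfalso; assumption)
  · intro i hi
    have := hC i hi
    have := strict_le hC (i+1) P.n (by omega) le_rfl
    (try dsimp only); split_ifs <;> first | omega | (exfalso; assumption)
  · intro i j hi hj hP
    obtain ⟨a, b, g1, g2, g3, g4, g5⟩ := hE i j hi hj hP
    have := strict_le hR (i+1) P.m (by omega) le_rfl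
    have := strict_le hC (j+1) P.n (by omega) le_rfl
    refine ⟨a, b, ?_, ?_, ?_, ?_, g5⟩ <;> (try dsimp only) <;> split_ifs <;>
      first | omega | (exfalso; omega) | (subst_vars; omega)

lemma im_iff {P M : BMat} (hm : 0 < P.m) (hn : 0 < P.n) :
    IntervalMinor P M ↔ PartitionContains M P := ⟨im_pc, pc_im hm hn⟩

lemma con_pos {M M' : BMat} (h : Relation.ReflTransGen Con M M') (hm : 0 < M.m) (hn : 0 < M.n) :
    0 < M'.m ∧ 0 < M'.n := by
  induction h with
  | refl => exact ⟨hm, hn⟩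
  | tail _ h ih =>
    rcases h with ⟨r, hr, hm, hn, he⟩ | ⟨r, hr, hn, hm, he⟩ <;> omega

end IM


namespace IM

/-- Row reflection relation. -/
def RR (P P' : BMat) : Prop := P'.m = P.m ∧ P'.n = P.n ∧
  ∀ a b, a < P.m → b < P.n → P'.entry a b = P.entry (P.m - 1 - a) b

/-- Column reflection relation. -/
def CR (P P' : BMat) : Prop := P'.m = P.m ∧ P'.n = P.n ∧
  ∀ a b, a < P.m → b < P.n → P'.entry a b = P.entry a (P.n - 1 - b)

lemma RR.symm {P P' : BMat} (h : RR P P') : RR P' P := by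
  obtain ⟨h1, h2, h3⟩ := h
  refine ⟨h1.symm, h2.symm, fun a b ha hb => ?_⟩
  rw [h3 _ b (by omega) (by omega)]
  congr 1; omega

lemma CR.symm {P P' : BMat} (h : CR P P') : CR P' P := by
  obtain ⟨h1, h2, h3⟩ := h
  refine ⟨h1.symm, h2.symm, fun a b ha hb => ?_⟩
  rw [h3 a _ (by omega) (by omega)]
  congr 1; omega

lemma rr_reflRows (P : BMat) : RR P (reflRows P) := ⟨rfl, rfl, fun _ _ _ _ => rfl⟩
lemma cr_reflCols (P : BMat) : CR P (reflCols P) := ⟨rfl, rfl, fun _ _ _ _ => rfl⟩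

lemma pc_rr {P P' M M' : BMat} (hP : RR P P') (hM : RR M M') (h : PartitionContains M P) :
    PartitionContains M' P' := by
  obtain ⟨R, C, hR, hC, hRm, hCn, hE⟩ := h
  obtain ⟨p1, p2, p3⟩ := hP
  obtain ⟨m1, m2, m3⟩ := hM
  refine ⟨fun a => M.m - R (P.m - a), C, ?_, ?_, ?_, ?_, ?_⟩
  · intro i hi
    have h1 := hR (P.m - (i+1)) (by omega)
    rw [show P.m - (i+1) + 1 = P.m - i by omega] at h1
    have h2 := strict_le hR (P.m - i) P.m (by omega) le_rfl
    dsimp only; omega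
  · intro j hj; exact hC j (by omega)
  · dsimp only; omega
  · rw [p2, m2]; exact hCn
  · intro i j hi hj hPe
    rw [p3 i j (by omega) (by omega)] at hPe
    obtain ⟨a, b, g1, g2, g3, g4, g5⟩ := hE _ j (by omega) (by omega) hPe
    rw [show P.m - 1 - i + 1 = P.m - i by omega] at g2
    have h2 := strict_le hR (P.m - i) P.m (by omega) le_rfl
    have h3 := strict_le hC (j+1) P.n (by omega) le_rfl
    have e1 : P.m - (i+1) = P.m - 1 - i := by omega
    refine ⟨M.m - 1 - a, b, by (try dsimp only); omega, by dsimp only; rw [e1]; omega, g3, g4, ?_⟩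
    rw [m3 _ b (by omega) (by omega), show M.m - 1 - (M.m - 1 - a) = a by omega]
    exact g5

lemma pc_cr {P P' M M' : BMat} (hP : CR P P') (hM : CR M M') (h : PartitionContains M P) :
    PartitionContains M' P' := by
  obtain ⟨R, C, hR, hC, hRm, hCn, hE⟩ := h
  obtain ⟨p1, p2, p3⟩ := hP
  obtain ⟨m1, m2, m3⟩ := hM
  refine ⟨R, fun a => M.n - C (P.n - a), ?_, ?_, ?_, ?_, ?_⟩
  · intro j hj; exact hR j (by omega)
  · intro i hi
    have h1 := hC (P.n - (i+1)) (by omega)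
    rw [show P.n - (i+1) + 1 = P.n - i by omega] at h1
    have h2 := strict_le hC (P.n - i) P.n (by omega) le_rfl
    dsimp only; omega
  · rw [p1, m1]; exact hRm
  · dsimp only; omega
  · intro j i hj hi hPe
    rw [p3 j i (by omega) (by omega)] at hPe
    obtain ⟨b, a, g3, g4, g1, g2, g5⟩ := hE j _ (by omega) (by omega) hPe
    rw [show P.n - 1 - i + 1 = P.n - i by omega] at g2
    have h2 := strict_le hC (P.n - i) P.n (by omega) le_rfl
    have h3 := strict_le hR (j+1) P.m (by omega) le_rfl
    have e1 : P.n - (i+1) = P.n - 1 - i := by omega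
    refine ⟨b, M.n - 1 - a, g3, g4, by (try dsimp only); omega, by dsimp only; rw [e1]; omega, ?_⟩
    rw [m3 b _ (by omega) (by omega), show M.n - 1 - (M.n - 1 - a) = a by omega]
    exact g5

lemma rr_setOne {M M' : BMat} (h : RR M M') {r c : ℕ} (hr : r < M.m) :
    RR (setOne M r c) (setOne M' (M.m - 1 - r) c) := by
  obtain ⟨m1, m2, m3⟩ := h
  refine ⟨m1, m2, fun a b ha hb => ?_⟩
  simp only [setOne] at ha hb ⊢
  rw [m3 a b ha hb]
  have : (a = M.m - 1 - r ∧ b = c) ↔ (M.m - 1 - a = r ∧ b = c) := by omega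
  simp only [this]

lemma cr_setOne {M M' : BMat} (h : CR M M') {r c : ℕ} (hc : c < M.n) :
    CR (setOne M r c) (setOne M' r (M.n - 1 - c)) := by
  obtain ⟨m1, m2, m3⟩ := h
  refine ⟨m1, m2, fun a b ha hb => ?_⟩
  simp only [setOne] at ha hb ⊢
  rw [m3 a b ha hb]
  have : (a = r ∧ b = M.n - 1 - c) ↔ (a = r ∧ M.n - 1 - b = c) := by omega
  simp only [this]

/-- Witness for unboundedness with `N` critical zeros. -/
def Wit (P : BMat) (N : ℕ) : Prop := ∃ (M : BMat) (r : ℕ) (f : ℕ → ℕ),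
  r < M.m ∧ ¬ PartitionContains M P ∧
  (∀ t, t < N → f t < M.n ∧ PartitionContains (setOne M r (f t)) P) ∧
  ∀ s t, s < t → t < N → ∃ g, f s < g ∧ g < f t ∧ M.entry r g = true

lemma wit_rr {P P' : BMat} {N : ℕ} (hP : RR P P') (h : Wit P N) : Wit P' N := by
  obtain ⟨M, r, f, hr, h1, h2, h3⟩ := h
  refine ⟨reflRows M, M.m - 1 - r, f, by simp [reflRows]; omega,
    fun hc => h1 (pc_rr hP.symm (rr_reflRows M).symm hc),
    fun t ht => ⟨(h2 t ht).1, pc_rr hP (rr_setOne (rr_reflRows M) hr) (h2 t ht).2⟩, ?_⟩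
  intro s t hst ht
  obtain ⟨g, g1, g2, g3⟩ := h3 s t hst ht
  refine ⟨g, g1, g2, ?_⟩
  simp only [reflRows]
  rw [show M.m - 1 - (M.m - 1 - r) = r by omega]; exact g3

lemma wit_cr {P P' : BMat} {N : ℕ} (hP : CR P P') (h : Wit P N) : Wit P' N := by
  obtain ⟨M, r, f, hr, h1, h2, h3⟩ := h
  refine ⟨reflCols M, r, fun t => M.n - 1 - f (N - 1 - t), hr,
    fun hc => h1 (pc_cr hP.symm (cr_reflCols M).symm hc),
    fun t ht => ⟨?_, pc_cr hP (cr_setOne (cr_reflCols M) (h2 _ (by omega)).1) (h2 _ (by omega)).2⟩, ?_⟩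
  · have := (h2 (N - 1 - t) (by omega)).1
    simp only [reflCols]; omega
  intro s t hst ht
  obtain ⟨g, g1, g2, g3⟩ := h3 (N-1-t) (N-1-s) (by omega) (by omega)
  have := (h2 (N - 1 - t) (by omega)).1
  have := (h2 (N - 1 - s) (by omega)).1
  refine ⟨M.n - 1 - g, by (try dsimp only); omega, by (try dsimp only); omega, ?_⟩
  simp only [reflCols]
  rw [show M.n - 1 - (M.n - 1 - g) = g by omega]; exact g3

lemma pc_mono {P M M' : BMat} (hm : M'.m = M.m) (hn : M'.n = M.n)
    (he : ∀ a b, a < M.m → b < M.n → M.entry a b = true → M'.entry a b = true)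
    (h : PartitionContains M P) : PartitionContains M' P := by
  obtain ⟨R, C, hR, hC, hRm, hCn, hE⟩ := h
  refine ⟨R, C, hR, hC, by omega, by omega, fun i j hi hj hP => ?_⟩
  obtain ⟨a, b, g1, g2, g3, g4, g5⟩ := hE i j hi hj hP
  have h2 := strict_le hR (i+1) P.m (by omega) le_rfl
  have h3 := strict_le hC (j+1) P.n (by omega) le_rfl
  exact ⟨a, b, g1, g2, g3, g4, he a b (by omega) (by omega) g5⟩

/-- number of in-range zeros -/
def zeros (M : BMat) : Finset (ℕ × ℕ) :=
  (Finset.range M.m ×ˢ Finset.range M.n).filter (fun p => M.entry p.1 p.2 = false)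

lemma mem_zeros (M : BMat) (p : ℕ × ℕ) :
    p ∈ zeros M ↔ p.1 < M.m ∧ p.2 < M.n ∧ M.entry p.1 p.2 = false := by
  simp [zeros, and_assoc]

lemma exists_critical (P : BMat) (hm : 0 < P.m) (hn : 0 < P.n) (s : ℕ) :
    ∀ M : BMat, (zeros M).card = s → ¬ PartitionContains M P →
    ∃ M', M'.m = M.m ∧ M'.n = M.n ∧ (∀ a b, M.entry a b = true → M'.entry a b = true) ∧
      CriticalFor (Av P) M' := by
  induction s using Nat.strong_induction_on with
  | _ s ih =>
    intro M hs hM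
    by_cases hc : CriticalFor (Av P) M
    · exact ⟨M, rfl, rfl, fun _ _ h => h, hc⟩
    · have hMA : M ∈ Av P := fun h => hM (im_pc h)
      simp only [CriticalFor, not_and, not_forall, not_not] at hc
      obtain ⟨i, j, hi, hj, he, hA⟩ := hc hMA
      have hlt : (zeros (setOne M i j)).card < s := by
        rw [← hs]
        apply Finset.card_lt_card
        refine Finset.ssubset_iff_of_subset ?_ |>.mpr ⟨(i, j), ?_, ?_⟩
        · rw [Finset.subset_iff]
          intro p hp
          rw [mem_zeros] at hp ⊢
          obtain ⟨h1, h2, h3⟩ := hp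
          refine ⟨h1, h2, ?_⟩
          simp only [setOne] at h3
          split_ifs at h3
          exact h3
        · simp [zeros, hi, hj, he]
        · simp [zeros, setOne]
      obtain ⟨M', h1, h2, h3, h4⟩ := ih _ hlt (setOne M i j) rfl
        (fun h => hA (pc_im hm hn h))
      refine ⟨M', h1, h2, fun a b hab => h3 a b ?_, h4⟩
      simp [setOne, hab]

lemma wit_unbounded {P : BMat} (hm : 0 < P.m) (hn : 0 < P.n) (h : ∀ N, Wit P N) :
    ¬ RowBounded (Av P) := by
  rintro ⟨K, hK⟩
  obtain ⟨M, r, f, hr, h1, h2, h3⟩ := h (K+1)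
  obtain ⟨M', hm', hn', he, hc⟩ := exists_critical P hm hn _ M rfl h1
  have hb := hK M' hc r (by omega)
  have hz : ∀ t, t < K+1 → M'.entry r (f t) = false := by
    intro t ht
    by_contra hcon
    apply hc.1
    apply pc_im hm hn
    refine pc_mono (M := setOne M r (f t)) (by simp [setOne, hm']) (by simp [setOne, hn']) ?_ (h2 t ht).2
    intro a b _ _ hab
    simp only [setOne] at hab
    split_ifs at hab with q
    · rw [q.1, q.2]; simpa using hcon
    · exact he a b hab
  have hst : ∀ t, ∃ q, t < K + 1 → q ≤ f t ∧ (∀ y, q ≤ y → y ≤ f t → M'.entry r y = false) ∧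
      (q = 0 ∨ M'.entry r (q-1) = true) := by
    intro t
    by_cases ht : t < K + 1
    · classical
      have hex : ∃ q, q ≤ f t ∧ ∀ y, q ≤ y → y ≤ f t → M'.entry r y = false :=
        ⟨f t, le_rfl, fun y y1 y2 => by rw [show y = f t by omega]; exact hz t ht⟩
      refine ⟨Nat.find hex, fun _ => ⟨(Nat.find_spec hex).1, (Nat.find_spec hex).2, ?_⟩⟩
      by_contra hcon
      push Not at hcon
      have hlt : Nat.find hex - 1 < Nat.find hex := by omega
      apply Nat.find_min hex hlt
      refine ⟨by have := (Nat.find_spec hex).1; omega, fun y y1 y2 => ?_⟩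
      by_cases hy : y = Nat.find hex - 1
      · rw [hy]; simpa using hcon.2
      · exact (Nat.find_spec hex).2 y (by omega) y2
    · exact ⟨0, fun h => absurd h ht⟩
  choose q hq using hst
  have hfin : {j | j < M'.n ∧ M'.entry r j = false ∧ (j = 0 ∨ M'.entry r (j - 1) = true)}.Finite :=
    (Set.finite_lt_nat M'.n).subset (fun x hx => hx.1)
  have : (Finset.range (K+1)).card ≤ rowRunCount M' r := by
    unfold rowRunCount
    rw [← Set.ncard_coe_finset]
    apply Set.ncard_le_ncard_of_injOn q _ _ hfin
    · intro t ht
      simp only [Finset.coe_range, Set.mem_Iio] at ht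
      have := hq t ht
      have := (h2 t ht).1
      exact ⟨by omega, (hq t ht).2.1 _ le_rfl (hq t ht).1, (hq t ht).2.2⟩
    · have key : ∀ s t, s < t → t < K+1 → q s ≠ q t := by
        intro s t hst ht heq
        obtain ⟨g, g1, g2, g3⟩ := h3 s t hst ht
        have a1 := (hq s (by omega)).1
        have := (hq t ht).2.1 g (by omega) (by omega)
        rw [he r g g3] at this
        exact absurd this (by simp)
      intro s hs t ht heq
      simp only [Finset.coe_range, Set.mem_Iio] at hs ht
      rcases lt_trichotomy s t with h | h | h
      · exact absurd heq (key s t h ht)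
      · exact h
      · exact absurd heq.symm (key t s h hs)
  simp at this
  omega

end IM


namespace IM

/-- the staircase matrix -/
def stair (k l r1 r3 c1 c2 c3 N : ℕ) : BMat :=
  ⟨r1 + 1 + N * (r3 - r1) + (k - 1 - r3), c1 + N * (c3 - c1 + 1) + (l - 1 - c3),
   fun x y => decide (x < r1 ∨ y < c1 ∨ r1 + 1 + N * (r3 - r1) ≤ x ∨ c1 + N * (c3 - c1 + 1) ≤ y ∨
     (x = r1 ∧ (y - c1) % (c3 - c1 + 1) ≠ c2 - c1) ∨
     (r1 < x ∧ (x - r1 - 1) / (r3 - r1) + (y - c1) / (c3 - c1 + 1) = N - 1))⟩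

lemma stair_avoid {P : BMat} {r1 r2 r3 c1 c2 c3 N : ℕ} (h12 : r1 < r2) (h23 : r2 < r3)
    (h3 : r3 < P.m) (d12 : c1 < c2) (d23 : c2 < c3) (d3 : c3 < P.n)
    (ea : P.entry r1 c2 = true) (eb : P.entry r2 c1 = true) (ed : P.entry r3 c3 = true) :
    ¬ PartitionContains (stair P.m P.n r1 r3 c1 c2 c3 N) P := by
  rintro ⟨R, C, hR, hC, hRm, hCn, hE⟩
  obtain ⟨xa, ya, a1, a2, a3, a4, a5⟩ := hE r1 c2 (by omega) (by omega) ea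
  obtain ⟨xb, yb, b1, b2, b3, b4, b5⟩ := hE r2 c1 (by omega) (by omega) eb
  obtain ⟨xd, yd, e1, e2, e3, e4, e5⟩ := hE r3 c3 (by omega) (by omega) ed
  clear hE
  obtain ⟨h, hh⟩ : ∃ h, h = r3 - r1 := ⟨_, rfl⟩
  obtain ⟨w, hw⟩ : ∃ w, w = c3 - c1 + 1 := ⟨_, rfl⟩
  simp only [stair, decide_eq_true_eq, ← hh, ← hw] at a5 b5 e5 hRm hCn
  have R1 := strict_le hR 0 r1 (by omega) (by omega)
  have R2 := strict_le hR (r1+1) r2 (by omega) (by omega)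
  have R3 := strict_le hR (r2+1) r3 (by omega) (by omega)
  have R4 := strict_le hR (r3+1) P.m (by omega) (by omega)
  have C1 := strict_le hC 0 c1 (by omega) (by omega)
  have C2 := strict_le hC (c1+1) c2 (by omega) (by omega)
  have C3 := strict_le hC (c2+1) c3 (by omega) (by omega)
  have C4 := strict_le hC (c3+1) P.n (by omega) (by omega)
  clear hR hC
  have b6 : (xb - r1 - 1) / h + (yb - c1) / w = N - 1 := by
    rcases b5 with q | q | q | q | q | q <;> omega
  have e6 : (xd - r1 - 1) / h + (yd - c1) / w = N - 1 := by
    rcases e5 with q | q | q | q | q | q <;> omega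
  have f1 : (xb - r1 - 1) / h ≤ (xd - r1 - 1) / h := Nat.div_le_div_right (by omega)
  have f2 : (yb - c1) / w ≤ (yd - c1) / w := Nat.div_le_div_right (by omega)
  have f3 : (xb - r1 - 1) / h = (xd - r1 - 1) / h := by omega
  have f4 : (yb - c1) / w = (yd - c1) / w := by omega
  have hp : 0 < h := by omega
  have wp : 0 < w := by omega
  have g1 := Nat.div_add_mod (yb - c1) w
  have g2 := Nat.mod_lt (yb - c1) wp
  have g3 := Nat.div_add_mod (yd - c1) w
  have g4 := Nat.mod_lt (yd - c1) wp
  rw [← f4] at g3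
  clear b5 e5
  have z0 : c1 ≤ yb := by clear a5 g1 g2 g3 g4 f1 f2 f3 f4 b6 e6; omega
  have z1 : yb + (c2 - c1) ≤ ya := by clear a5 g1 g2 g3 g4 f1 f2 f3 f4 b6 e6; omega
  have z2 : ya + (c3 - c2) ≤ yd := by clear a5 g1 g2 g3 g4 f1 f2 f3 f4 b6 e6; omega
  have y1 : ya - c1 = (c2 - c1) + w * ((yb - c1) / w) := by
    clear a5 f1 f2 f3 f4 b6 e6
    clear R1 R2 R3 R4 C1 C2 C3 C4
    generalize w * ((yb - c1) / w) = qq at *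
    omega
  have y2 : (ya - c1) % w = c2 - c1 := by
    rw [y1, Nat.add_mul_mod_self_left, Nat.mod_eq_of_lt (by omega)]
  have y3 : (ya - c1) / w = (yb - c1) / w := by
    rw [y1, Nat.add_mul_div_left _ _ wp, Nat.div_eq_of_lt (a := c2 - c1) (by omega), zero_add]
  have x1 : (xa - r1 - 1) / h + (ya - c1) / w = N - 1 ∧ r1 < xa := by
    have w1 : r1 ≤ xa := by clear a5 g1 g2 g3 g4 f1 f2 f3 f4 b6 e6 y1 y2 y3; omega
    have w2 : xa < r1 + 1 + N * h := by clear a5 g1 g2 g3 g4 f1 f2 f3 f4 b6 e6 y1 y2 y3; omega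
    have w3 : ya < c1 + N * w := by clear a5 g1 g2 g3 g4 f1 f2 f3 f4 b6 e6 y1 y2 y3; omega
    clear R1 R2 R3 R4 C1 C2 C3 C4 g1 g2 g3 g4 f1 f2 f3 f4 b6 e6 y1 y3
    rcases a5 with q | q | q | q | q | q
    · exact absurd q (by omega)
    · exact absurd q (by omega)
    · exact absurd q (by omega)
    · exact absurd q (by omega)
    · exact absurd y2 q.2
    · exact ⟨q.2, q.1⟩
  clear a5
  have w1 : xb < xd := by clear g1 g2 g3 g4 f1 f2 f3 f4 b6 e6 y1 y2 y3; omega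
  have w2 : xa + (r3 - r1) ≤ xd := by clear g1 g2 g3 g4 f1 f2 f3 f4 b6 e6 y1 y2 y3; omega
  have x2 : (xa - r1 - 1) / h = (xd - r1 - 1) / h := by omega
  have g5 := Nat.div_add_mod (xa - r1 - 1) h
  have g6 := Nat.div_add_mod (xd - r1 - 1) h
  have g7 := Nat.mod_lt (xd - r1 - 1) hp
  rw [← x2] at g6
  clear R1 R2 R3 R4 C1 C2 C3 C4 g1 g2 g3 g4 f1 f2 f3 f4 b6 e6 y1 y2 y3
  generalize h * ((xa - r1 - 1) / h) = qq at *
  omega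

lemma stair_flip {P : BMat} {r1 r2 r3 c1 c2 c3 N : ℕ} (h12 : r1 < r2) (h23 : r2 < r3)
    (h3 : r3 < P.m) (d12 : c1 < c2) (d23 : c2 < c3) (d3 : c3 < P.n) {t : ℕ} (ht : t < N) :
    PartitionContains (setOne (stair P.m P.n r1 r3 c1 c2 c3 N) r1 (c2 + (c3 - c1 + 1) * t)) P := by
  obtain ⟨h, hh⟩ : ∃ h, h = r3 - r1 := ⟨_, rfl⟩
  obtain ⟨w, hw⟩ : ∃ w, w = c3 - c1 + 1 := ⟨_, rfl⟩
  simp only [stair, setOne, ← hh, ← hw]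
  have hp : 0 < h := by omega
  have wp : 0 < w := by omega
  have k1 : h * (N - 1 - t) + h ≤ N * h := by
    calc h * (N - 1 - t) + h = h * (N - 1 - t + 1) := by ring
      _ ≤ h * N := Nat.mul_le_mul_left _ (by omega)
      _ = N * h := by ring
  have k2 : w * t + w ≤ N * w := by
    calc w * t + w = w * (t + 1) := by ring
      _ ≤ w * N := Nat.mul_le_mul_left _ (by omega)
      _ = N * w := by ring
  refine ⟨fun a => if a ≤ r1 then a else if a ≤ r3 then h * (N - 1 - t) + a else N * h + a - h,
    fun b => if b < c1 then b else if b ≤ c3 then w * t + b else N * w + b - w, ?_, ?_, ?_, ?_, ?_⟩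
  · intro i hi; dsimp only; split_ifs <;> omega
  · intro i hi; dsimp only; split_ifs <;> omega
  · dsimp only; split_ifs <;> omega
  · dsimp only; split_ifs <;> omega
  · intro a b ha hb _
    refine ⟨_, _, le_rfl, ?_, le_rfl, ?_, ?_⟩
    · dsimp only; split_ifs <;> omega
    · dsimp only; split_ifs <;> omega
    · dsimp only
      by_cases hab : a = r1 ∧ b = c2
      · rw [if_pos]
        refine ⟨?_, ?_⟩ <;> split_ifs <;> omega
      · rw [if_neg (by split_ifs <;> omega), decide_eq_true_eq]
        by_cases q1 : a < r1
        · left; split_ifs <;> omega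
        by_cases q2 : b < c1
        · right; left; split_ifs <;> omega
        by_cases q3 : r3 < a
        · right; right; left; split_ifs <;> omega
        by_cases q4 : c3 < b
        · right; right; right; left; split_ifs <;> omega
        rw [if_neg q2, if_pos (show b ≤ c3 by omega)]
        have e1 : w * t + b - c1 = (b - c1) + w * t := by omega
        by_cases q5 : a = r1
        · right; right; right; right; left
          rw [if_pos (by omega)]
          refine ⟨q5, ?_⟩
          rw [e1, Nat.add_mul_mod_self_left, Nat.mod_eq_of_lt (by omega)]
          omega
        · right; right; right; right; right
          rw [if_neg (by omega), if_pos (by omega)]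
          refine ⟨by omega, ?_⟩
          have e2 : h * (N - 1 - t) + a - r1 - 1 = (a - r1 - 1) + h * (N - 1 - t) := by omega
          rw [e1, e2, Nat.add_mul_div_left _ _ wp, Nat.add_mul_div_left _ _ hp,
            Nat.div_eq_of_lt (by omega), Nat.div_eq_of_lt (by omega)]
          omega

/-- A triple of 1-entries of `P` in the position of `Q1`. -/
def Trip (P : BMat) : Prop := ∃ r1 r2 r3 c1 c2 c3, r1 < r2 ∧ r2 < r3 ∧ r3 < P.m ∧ c1 < c2 ∧
  c2 < c3 ∧ c3 < P.n ∧ P.entry r1 c2 = true ∧ P.entry r2 c1 = true ∧ P.entry r3 c3 = true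

lemma trip_wit {P : BMat} (h : Trip P) (N : ℕ) : Wit P N := by
  obtain ⟨r1, r2, r3, c1, c2, c3, h12, h23, h3, d12, d23, d3, ea, eb, ed⟩ := h
  refine ⟨stair P.m P.n r1 r3 c1 c2 c3 N, r1, fun t => c2 + (c3 - c1 + 1) * t, ?_,
    stair_avoid h12 h23 h3 d12 d23 d3 ea eb ed,
    fun t ht => ⟨?_, stair_flip h12 h23 h3 d12 d23 d3 ht⟩, ?_⟩
  · simp [stair]; omega
  · obtain ⟨w, hw⟩ : ∃ w, w = c3 - c1 + 1 := ⟨_, rfl⟩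
    have k2 : w * t + w ≤ N * w := by
      calc w * t + w = w * (t + 1) := by ring
        _ ≤ w * N := Nat.mul_le_mul_left _ (by omega)
        _ = N * w := by ring
    simp only [stair, ← hw]; omega
  · intro s t hst ht
    obtain ⟨w, hw⟩ : ∃ w, w = c3 - c1 + 1 := ⟨_, rfl⟩
    simp only [← hw]
    have k2 : w * s + w ≤ w * t := by
      calc w * s + w = w * (s + 1) := by ring
        _ ≤ w * t := Nat.mul_le_mul_left _ (by omega)
    refine ⟨c2 + w * s + 1, by omega, by omega, ?_⟩
    simp only [stair, ← hw]
    rw [decide_eq_true_eq]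
    right; right; right; right; left
    refine ⟨by trivial, ?_⟩
    rw [show c2 + w * s + 1 - c1 = (c2 + 1 - c1) + w * s by omega, Nat.add_mul_mod_self_left,
      Nat.mod_eq_of_lt (by omega)]
    omega

lemma trip_unbounded {P : BMat} (h : Trip P) : ¬ RowBounded (Av P) := by
  have h' := h
  obtain ⟨r1, r2, r3, c1, c2, c3, h12, h23, h3, d12, d23, d3, ea, eb, ed⟩ := h'
  exact wit_unbounded (by omega) (by omega) (trip_wit h)

lemma pc_three {P Q : BMat} (hm : Q.m = 3) (hn : Q.n = 3) (h : PartitionContains P Q)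
    (x0 x1 x2 : ℕ) (g0 : x0 < 3) (g1 : x1 < 3) (g2 : x2 < 3)
    (e0 : Q.entry 0 x0 = true) (e1 : Q.entry 1 x1 = true) (e2 : Q.entry 2 x2 = true) :
    ∃ a0 a1 a2 b0 b1 b2, a0 < a1 ∧ a1 < a2 ∧ a2 < P.m ∧ b0 < P.n ∧ b1 < P.n ∧ b2 < P.n ∧
      P.entry a0 b0 = true ∧ P.entry a1 b1 = true ∧ P.entry a2 b2 = true ∧
      (x0 < x1 → b0 < b1) ∧ (x1 < x0 → b1 < b0) ∧ (x0 < x2 → b0 < b2) ∧ (x2 < x0 → b2 < b0) ∧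
      (x1 < x2 → b1 < b2) ∧ (x2 < x1 → b2 < b1) := by
  obtain ⟨R, C, hR, hC, hRm, hCn, hE⟩ := h
  obtain ⟨a0, b0, p1, p2, p3, p4, p5⟩ := hE 0 x0 (by omega) (by omega) e0
  obtain ⟨a1, b1, q1, q2, q3, q4, q5⟩ := hE 1 x1 (by omega) (by omega) e1
  obtain ⟨a2, b2, s1, s2, s3, s4, s5⟩ := hE 2 x2 (by omega) (by omega) e2
  rw [hm] at hRm
  have mono : ∀ x y, x < y → y < 3 → C (x+1) ≤ C y := by
    intro x y hxy hy
    have := strict_le hC (x+1) y (by omega) (by omega); omega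
  have top : ∀ x, x < 3 → C (x+1) ≤ P.n := by
    intro x hx
    have := strict_le hC (x+1) Q.n (by omega) (by omega); omega
  have t0 := top _ g0
  have t1 := top _ g1
  have t2 := top _ g2
  simp only [zero_add, Nat.reduceAdd] at *
  refine ⟨a0, a1, a2, b0, b1, b2, by omega, by omega, by omega, by omega, by omega, by omega,
    p5, q5, s5, ?_, ?_, ?_, ?_, ?_, ?_⟩ <;> intro hx <;> have := mono _ _ hx (by assumption) <;> omega

lemma three_pc {P Q : BMat} (hm : Q.m = 3) (hn : Q.n = 3) (R C : ℕ → ℕ)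
    (hR : ∀ i, i < 2 → R i < R (i+1)) (hC : ∀ i, i < 2 → C i < C (i+1))
    (hRm : R 2 < P.m) (hCn : C 2 < P.n)
    (hE : ∀ i j, i < 3 → j < 3 → Q.entry i j = true → P.entry (R i) (C j) = true) :
    PartitionContains P Q := by
  refine ⟨fun x => if x < 3 then R x else R 2 + 1, fun x => if x < 3 then C x else C 2 + 1,
    ?_, ?_, ?_, ?_, ?_⟩
  · intro i hi
    rw [hm] at hi
    interval_cases i
    · simpa using hR 0 (by omega)
    · simpa using hR 1 (by omega)
    · simp
  · intro i hi
    rw [hn] at hi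
    interval_cases i
    · simpa using hC 0 (by omega)
    · simpa using hC 1 (by omega)
    · simp
  · simp [hm]; omega
  · simp [hn]; omega
  · intro i j hi hj hq
    rw [hm] at hi; rw [hn] at hj
    refine ⟨R i, C j, by simp [hi], ?_, by simp [hj], ?_, hE i j hi hj hq⟩
    · interval_cases i
      · simpa using hR 0 (by omega)
      · simpa using hR 1 (by omega)
      · simp
    · interval_cases j
      · simpa using hC 0 (by omega)
      · simpa using hC 1 (by omega)
      · simp

lemma unb1 {P : BMat} (h : IntervalMinor Q1 P) : ¬ RowBounded (Av P) := by
  obtain ⟨a0, a1, a2, b0, b1, b2, h1, h2, h3, h4, h5, h6, e0, e1, e2, g⟩ :=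
    pc_three rfl rfl (im_pc h) 1 0 2 (by omega) (by omega) (by omega) rfl rfl rfl
  exact trip_unbounded ⟨a0, a1, a2, b1, b0, b2, by omega, by omega, by omega, by omega, by omega,
    by omega, e0, e1, e2⟩

lemma unb_cr {P P' : BMat} (hP : CR P P') (h : Trip P') : ∀ N, Wit P N :=
  fun N => wit_cr hP.symm (trip_wit h N)

lemma flip2 {P : BMat} (a0 a1 a2 b0 b1 b2 : ℕ) (h1 : a0 < a1) (h2 : a1 < a2) (h3 : a2 < P.m)
    (h4 : b2 < b0) (h5 : b0 < b1) (h6 : b1 < P.n) (e0 : P.entry a0 b0 = true)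
    (e1 : P.entry a1 b1 = true) (e2 : P.entry a2 b2 = true) : Trip (reflCols P) := by
  refine ⟨a0, a1, a2, P.n - 1 - b1, P.n - 1 - b0, P.n - 1 - b2, h1, h2, h3, by omega, by omega,
    by simp [reflCols]; omega, ?_, ?_, ?_⟩ <;> simp only [reflCols]
  · rw [show P.n - 1 - (P.n - 1 - b0) = b0 by omega]; exact e0
  · rw [show P.n - 1 - (P.n - 1 - b1) = b1 by omega]; exact e1
  · rw [show P.n - 1 - (P.n - 1 - b2) = b2 by omega]; exact e2

lemma unb2 {P : BMat} (h : IntervalMinor Q2 P) : ¬ RowBounded (Av P) := by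
  obtain ⟨a0, a1, a2, b0, b1, b2, h1, h2, h3, h4, h5, h6, e0, e1, e2, g⟩ :=
    pc_three rfl rfl (im_pc h) 1 2 0 (by omega) (by omega) (by omega) rfl rfl rfl
  exact wit_unbounded (by omega) (by omega) (fun N => wit_cr (cr_reflCols P).symm (trip_wit
    (flip2 a0 a1 a2 b0 b1 b2 h1 h2 h3 (by omega) (by omega) h5 e0 e1 e2) N))

lemma unb4 {P : BMat} (h : IntervalMinor Q4 P) : ¬ RowBounded (Av P) := by
  obtain ⟨a0, a1, a2, b0, b1, b2, h1, h2, h3, h4, h5, h6, e0, e1, e2, g⟩ :=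
    pc_three rfl rfl (im_pc h) 2 0 1 (by omega) (by omega) (by omega) rfl rfl rfl
  refine wit_unbounded (by omega) (by omega) (fun N => wit_rr (rr_reflRows P).symm (trip_wit ?_ N))
  refine ⟨P.m - 1 - a2, P.m - 1 - a1, P.m - 1 - a0, b1, b2, b0, by omega, by omega,
    by simp [reflRows]; omega, by omega, by omega, h4, ?_, ?_, ?_⟩ <;> simp only [reflRows]
  · rw [show P.m - 1 - (P.m - 1 - a2) = a2 by omega]; exact e2
  · rw [show P.m - 1 - (P.m - 1 - a1) = a1 by omega]; exact e1
  · rw [show P.m - 1 - (P.m - 1 - a0) = a0 by omega]; exact e0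

lemma unb3 {P : BMat} (h : IntervalMinor Q3 P) : ¬ RowBounded (Av P) := by
  obtain ⟨a0, a1, a2, b0, b1, b2, h1, h2, h3, h4, h5, h6, e0, e1, e2, g⟩ :=
    pc_three rfl rfl (im_pc h) 0 2 1 (by omega) (by omega) (by omega) rfl rfl rfl
  refine wit_unbounded (by omega) (by omega) (fun N => wit_rr (rr_reflRows P).symm
    (wit_cr (cr_reflCols (reflRows P)).symm (trip_wit
    (flip2 (P := reflRows P) (P.m - 1 - a2) (P.m - 1 - a1) (P.m - 1 - a0) b2 b1 b0 (by omega) (by omega)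
      (by simp [reflRows]; omega) (by omega) (by omega) h5 ?_ ?_ ?_) N))) <;> simp only [reflRows]
  · rw [show P.m - 1 - (P.m - 1 - a2) = a2 by omega]; exact e2
  · rw [show P.m - 1 - (P.m - 1 - a1) = a1 by omega]; exact e1
  · rw [show P.m - 1 - (P.m - 1 - a0) = a0 by omega]; exact e0

/-- every three 1-entries of `P` in distinct rows and columns are monotone -/
def NoQ (P : BMat) : Prop := ∀ a0 b0 a1 b1 a2 b2, a0 < a1 → a1 < a2 → a2 < P.m →
  b0 < P.n → b1 < P.n → b2 < P.n → P.entry a0 b0 = true → P.entry a1 b1 = true →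
  P.entry a2 b2 = true → b0 = b1 ∨ b1 = b2 ∨ b0 = b2 ∨ (b0 < b1 ∧ b1 < b2) ∨ (b2 < b1 ∧ b1 < b0)

lemma noQ_of {P : BMat} (h1 : ¬ IntervalMinor Q1 P) (h2 : ¬ IntervalMinor Q2 P)
    (h3 : ¬ IntervalMinor Q3 P) (h4 : ¬ IntervalMinor Q4 P) : NoQ P := by
  intro a0 b0 a1 b1 a2 b2 h01 h12 ha g0 g1 g2 e0 e1 e2
  by_contra hcon
  have key : ∀ Q : BMat, Q.m = 3 → Q.n = 3 → ¬ IntervalMinor Q P → ∀ c0 c1 c2, c0 < c1 → c1 < c2 → c2 < P.n →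
    (∀ i j, i < 3 → j < 3 → Q.entry i j = true →
      P.entry (if i = 0 then a0 else if i = 1 then a1 else a2)
        (if j = 0 then c0 else if j = 1 then c1 else c2) = true) → False := by
    intro Q hm hn hQ c0 c1 c2 hc1 hc2 hc3 hE
    apply hQ
    apply pc_im (by omega) (by omega)
    refine three_pc hm hn (fun i => if i = 0 then a0 else if i = 1 then a1 else a2)
      (fun j => if j = 0 then c0 else if j = 1 then c1 else c2) ?_ ?_ ?_ ?_ hE
    · intro i hi; interval_cases i <;> simpa
    · intro i hi; interval_cases i <;> simpa
    · simpa
    · simpa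
  rcases lt_or_ge b0 b1 with q1 | q1
  · rcases lt_or_ge b2 b0 with q2 | q2
    · refine key Q2 rfl rfl h2 b2 b0 b1 q2 q1 g1 ?_
      intro i j hi hj; interval_cases i <;> interval_cases j <;> simp [Q2, e0, e1, e2]
    · refine key Q3 rfl rfl h3 b0 b2 b1 (by omega) (by omega) g1 ?_
      intro i j hi hj; interval_cases i <;> interval_cases j <;> simp [Q3, e0, e1, e2]
  · rcases lt_or_ge b2 b0 with q2 | q2
    · refine key Q4 rfl rfl h4 b1 b2 b0 (by omega) (by omega) g0 ?_
      intro i j hi hj; interval_cases i <;> interval_cases j <;> simp [Q4, e0, e1, e2]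
    · refine key Q1 rfl rfl h1 b1 b0 b2 (by omega) (by omega) g2 ?_
      intro i j hi hj; interval_cases i <;> interval_cases j <;> simp [Q1, e0, e1, e2]

end IM


namespace IM

/-- in-range 1-entry -/
def E (P : BMat) (a b : ℕ) : Prop := a < P.m ∧ b < P.n ∧ P.entry a b = true

/-- strict up to k -/
lemma strict_from {R : ℕ → ℕ} {lo k : ℕ} (h : ∀ i, lo ≤ i → i < k → R i < R (i+1)) :
    ∀ a b, lo ≤ a → a ≤ b → b ≤ k → R a + (b - a) ≤ R b := by
  intro a b hl hab
  induction b, hab using Nat.le_induction with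
  | base => intro _; omega
  | succ b hab ih =>
    intro hb
    have := ih (by omega)
    have := h b (by omega) (by omega)
    omega

/-- The assembly lemma. -/
lemma core {P M : BMat} {i j r : ℕ} (hi : i < P.m) (hj : j < P.n)
    {R Cs Ct G : ℕ → ℕ} {J1 J2 : ℕ} (hR : ∀ a, a < P.m → R a < R (a+1)) (hRm : R P.m ≤ M.m)
    (hr1 : R i ≤ r) (hr2 : r < R (i+1)) (hJ1 : J1 ≤ j + 1) (hJ2 : j ≤ J2) (hJ2' : J2 ≤ P.n)
    (hG : ∀ x, x < 2 * P.n + 2 → G x < G (x+1)) (hGn : G (2 * P.n + 2) ≤ M.n)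
    (hGe : ∀ x, x ≤ 2 * P.n + 2 → M.entry r (G x) = true)
    (hCs : ∀ b, b + 1 < J1 → Cs b < Cs (b+1)) (hCs' : ∀ b, b < J1 → Cs b ≤ G 0)
    (hCt : ∀ b, J2 < b → b < P.n → Ct b < Ct (b+1))
    (hCt' : ∀ b, J2 < b → b ≤ P.n → G (2 * P.n + 2) < Ct b) (hCtn : Ct P.n ≤ M.n)
    (hE : ∀ a b, E P a b → (a = i ∧ b = j) ∨
      (b < J1 ∧ ∃ x y, R a ≤ x ∧ x < R (a+1) ∧ Cs b ≤ y ∧ (b + 1 < J1 → y < Cs (b+1)) ∧ y ≤ G 0 ∧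
        M.entry x y = true) ∨
      (b < j ∧ J1 ≤ b + 1 ∧ a = i) ∨
      (J2 ≤ b ∧ ∃ x y, R a ≤ x ∧ x < R (a+1) ∧ (J2 < b → Ct b ≤ y) ∧ y < Ct (b+1) ∧
        G (2 * P.n + 2) ≤ y ∧ M.entry x y = true) ∨
      (j < b ∧ b ≤ J2 ∧ a = i)) : PartitionContains M P := by
  have G0 := fun a b h1 h2 => strict_le hG a b h1 h2
  let C : ℕ → ℕ := fun b => if b ≤ j then (if b < J1 then Cs b else G (b - J1) + 1)
    else if b ≤ J2 then G (2 * P.n + 2 - (J2 - b)) else Ct b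
  have C1 : ∀ b, b ≤ j → b < J1 → C b = Cs b := by
    intro b h1 h2; simp only [C, if_pos h1, if_pos h2]
  have C2 : ∀ b, b ≤ j → J1 ≤ b → C b = G (b - J1) + 1 := by
    intro b h1 h2; simp only [C, if_pos h1, if_neg (show ¬ b < J1 by omega)]
  have C3 : ∀ b, j < b → b ≤ J2 → C b = G (2 * P.n + 2 - (J2 - b)) := by
    intro b h1 h2; simp only [C, if_neg (show ¬ b ≤ j by omega), if_pos h2]
  have C4 : ∀ b, j < b → J2 < b → C b = Ct b := by
    intro b h1 h2; simp only [C, if_neg (show ¬ b ≤ j by omega), if_neg (show ¬ b ≤ J2 by omega)]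
  have lo : C j ≤ G P.n + 1 := by
    by_cases h : j < J1
    · rw [C1 j le_rfl h]
      have := hCs' j h
      have := G0 0 P.n (by omega) (by omega)
      omega
    · rw [C2 j le_rfl (by omega)]
      have := G0 (j - J1) P.n (by omega) (by omega)
      omega
  have hi' : G (P.n + 2) ≤ C (j+1) := by
    by_cases h : j + 1 ≤ J2
    · rw [C3 _ (by omega) h]
      have := G0 (P.n + 2) (2 * P.n + 2 - (J2 - (j+1))) (by omega) (by omega)
      omega
    · rw [C4 _ (by omega) (by omega)]
      have := hCt' (j+1) (by omega) (by omega)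
      have := G0 (P.n + 2) (2 * P.n + 2) (by omega) (by omega)
      omega
  have mid1 := G0 P.n (P.n + 1) (by omega) (by omega)
  have mid2 := G0 (P.n + 1) (P.n + 2) (by omega) (by omega)
  have gl := G0 0 P.n (by omega) (by omega)
  have gr := G0 (P.n + 2) (2 * P.n + 2) (by omega) (by omega)
  refine ⟨R, C, hR, ?_, hRm, ?_, ?_⟩
  · intro b hb
    rcases lt_trichotomy b j with h | h | h
    · by_cases q : b < J1
      · rw [C1 b (by omega) q]
        by_cases q' : b + 1 < J1
        · rw [C1 _ (by omega) q']; exact hCs b q'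
        · rw [C2 _ (by omega) (by omega), show b + 1 - J1 = 0 by omega]
          have := hCs' b q; omega
      · rw [C2 b (by omega) (by omega), C2 _ (by omega) (by omega)]
        have := hG (b - J1) (by omega)
        rw [show b + 1 - J1 = b - J1 + 1 by omega]; omega
    · subst h; omega
    · by_cases q : b ≤ J2
      · rw [C3 b h q]
        by_cases q' : b + 1 ≤ J2
        · rw [C3 _ (by omega) q']
          have := G0 (2 * P.n + 2 - (J2 - b)) (2 * P.n + 2 - (J2 - (b+1))) (by omega) (by omega)
          omega
        · rw [C4 _ (by omega) (by omega), show 2 * P.n + 2 - (J2 - b) = 2 * P.n + 2 by omega]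
          exact hCt' _ (by omega) (by omega)
      · rw [C4 b h (by omega), C4 _ (by omega) (by omega)]
        exact hCt b (by omega) hb
  · by_cases q : P.n ≤ J2
    · rw [C3 _ hj q, show 2 * P.n + 2 - (J2 - P.n) = 2 * P.n + 2 by omega]; exact hGn
    · rw [C4 _ hj (by omega)]; exact hCtn
  · intro a b ha hb hab
    rcases hE a b ⟨ha, hb, hab⟩ with ⟨rfl, rfl⟩ | ⟨h, x, y, h1, h2, h3, h4, h5, h6⟩ | ⟨h1, h2, rfl⟩ |
      ⟨h, x, y, h1, h2, h3, h4, h5, h6⟩ | ⟨h1, h2, rfl⟩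
    · exact ⟨r, G (P.n + 1), hr1, hr2, by omega, by omega, hGe _ (by omega)⟩
    · refine ⟨x, y, h1, h2, ?_, ?_, h6⟩
      · rw [C1 b (by omega) h]; exact h3
      · by_cases q : b + 1 < J1
        · rw [C1 _ (by omega) q]; exact h4 q
        · by_cases q' : b < j
          · rw [C2 _ (by omega) (by omega), show b + 1 - J1 = 0 by omega]; omega
          · have : b = j := by omega
            subst this; omega
    · refine ⟨r, G (b + 1 - J1), hr1, hr2, ?_, ?_, hGe _ (by omega)⟩
      · by_cases q : b < J1
        · rw [C1 b (by omega) q, show b + 1 - J1 = 0 by omega]; exact hCs' b q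
        · rw [C2 b (by omega) (by omega)]
          have := hG (b - J1) (by omega)
          rw [show b + 1 - J1 = b - J1 + 1 by omega]; omega
      · rw [C2 _ (by omega) (by omega)]; omega
    · refine ⟨x, y, h1, h2, ?_, ?_, h6⟩
      · by_cases q : J2 < b
        · rw [C4 b (by omega) q]; exact h3 q
        · by_cases q' : j < b
          · rw [C3 b q' (by omega), show 2 * P.n + 2 - (J2 - b) = 2 * P.n + 2 by omega]; omega
          · have : b = j := by omega
            subst this; omega
      · rw [C4 _ (by omega) (by omega)]; exact h4
    · refine ⟨r, G (2 * P.n + 2 - (J2 - b)), hr1, hr2, ?_, ?_, hGe _ (by omega)⟩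
      · rw [C3 b h1 h2]
      · by_cases q' : b + 1 ≤ J2
        · rw [C3 _ (by omega) q']
          have := G0 (2 * P.n + 2 - (J2 - b)) (2 * P.n + 2 - (J2 - (b+1))) (by omega) (by omega)
          omega
        · rw [C4 _ (by omega) (by omega), show 2 * P.n + 2 - (J2 - b) = 2 * P.n + 2 by omega]
          exact hCt' _ (by omega) (by omega)

/-- One partition embedding all of `P` but the entry `(i,j)`. -/
structure Emb (P M : BMat) (i j r : ℕ) (R C : ℕ → ℕ) : Prop where
  hR : ∀ a, a < P.m → R a < R (a+1)
  hC : ∀ b, b < P.n → C b < C (b+1)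
  hm : R P.m ≤ M.m
  hn : C P.n ≤ M.n
  r1 : R i ≤ r
  r2 : r < R (i+1)
  hE : ∀ a b, E P a b → (a = i ∧ b = j) ∨ ∃ x y, R a ≤ x ∧ x < R (a+1) ∧ C b ≤ y ∧ y < C (b+1) ∧
    M.entry x y = true

/-- The data used in the two-embeddings argument. -/
structure Duo (P M : BMat) (i j r : ℕ) (Rs Cs Rt Ct G : ℕ → ℕ) : Prop where
  hi : i < P.m
  hj : j < P.n
  s : Emb P M i j r Rs Cs
  t : Emb P M i j r Rt Ct
  hG : ∀ x, x < 2 * P.n + 2 → G x < G (x+1)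
  hGe : ∀ x, x ≤ 2 * P.n + 2 → M.entry r (G x) = true
  sG : Cs (j+1) ≤ G 0
  Gt : G (2 * P.n + 2) < Ct j

/-- the row interval `a` of `X` lies in that of `R` -/
def Fit (R X : ℕ → ℕ) (a : ℕ) : Prop := R a ≤ X a ∧ X (a+1) ≤ R (a+1)

lemma ex_J1 {P : BMat} {i j : ℕ}
    (h : ∀ b0, b0 < j → E P i b0 → ∀ a b, a ≠ i → b < j → E P a b → b ≤ b0) :
    ∃ J1, J1 ≤ j ∧ (∀ a b, a ≠ i → b < j → E P a b → b < J1) ∧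
      (∀ b0, b0 < j → E P i b0 → J1 ≤ b0 + 1) := by
  classical
  by_cases hex : ∃ J, ∀ a b, a ≠ i → b < j → E P a b → b < J
  · refine ⟨Nat.find hex, Nat.find_min' hex (fun a b _ hb _ => hb), Nat.find_spec hex, ?_⟩
    intro b0 hb0 he
    refine Nat.find_min' hex (fun a b ha hb hab => ?_)
    have := h b0 hb0 he a b ha hb hab
    omega
  · exact absurd ⟨j, fun a b _ hb _ => hb⟩ hex

lemma ex_J2 {P : BMat} {i j : ℕ} (hj : j < P.n)
    (h : ∀ b0, j < b0 → E P i b0 → ∀ a b, a ≠ i → j < b → E P a b → b0 ≤ b) :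
    ∃ J2, j < J2 ∧ J2 ≤ P.n ∧ (∀ a b, a ≠ i → j < b → E P a b → J2 ≤ b) ∧
      (∀ b0, j < b0 → E P i b0 → b0 ≤ J2) := by
  classical
  by_cases hex : ∃ b, j < b ∧ ∃ a, a ≠ i ∧ E P a b
  · obtain ⟨h1, a, h2, h3⟩ := Nat.find_spec hex
    refine ⟨Nat.find hex, h1, h3.2.1.le, ?_, ?_⟩
    · intro a b ha hb hab
      exact Nat.find_min' hex ⟨hb, a, ha, hab⟩
    · intro b0 hb0 he
      exact h b0 hb0 he a _ h2 h1 h3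
  · refine ⟨P.n, hj, le_rfl, ?_, fun b0 _ he => he.2.1.le⟩
    intro a b ha hb hab
    exact absurd ⟨b, hb, a, ha, hab⟩ hex

lemma final {P M : BMat} {i j r : ℕ} {Rs Cs Rt Ct G : ℕ → ℕ} (d : Duo P M i j r Rs Cs Rt Ct G)
    {R : ℕ → ℕ} (hR : ∀ a, a < P.m → R a < R (a+1)) (hRm : R P.m ≤ M.m)
    (hr1 : R i ≤ r) (hr2 : r < R (i+1)) (ls rt : Prop)
    (hL : ∀ a b, a ≠ i → b < j → E P a b → Fit R Rs a)
    (hRi : ∀ a b, a ≠ i → j < b → E P a b → Fit R Rt a)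
    (hM : ∀ a, a ≠ i → E P a j → (ls ∧ Fit R Rs a) ∨ (rt ∧ Fit R Rt a))
    (hls : ls → ∀ b, b < j → E P i b → Fit R Rs i)
    (hrt : rt → ∀ b, j < b → E P i b → Fit R Rt i)
    (hnls : ¬ ls → ∀ b0, b0 < j → E P i b0 → ∀ a b, a ≠ i → b < j → E P a b → b ≤ b0)
    (hnrt : ¬ rt → ∀ b0, j < b0 → E P i b0 → ∀ a b, a ≠ i → j < b → E P a b → b0 ≤ b) :
    PartitionContains M P := by
  have hj := d.hj
  have csj : ∀ b, b ≤ j + 1 → Cs b ≤ G 0 := by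
    intro b hb
    have := strict_le d.s.hC b (j+1) hb (by omega)
    have := d.sG
    omega
  have ctj : ∀ b, j ≤ b → b ≤ P.n → G (2 * P.n + 2) < Ct b := by
    intro b hb hb'
    have := strict_le d.t.hC j b hb (by omega)
    have := d.Gt
    omega
  obtain ⟨J1, J1a, J1b, J1c, J1d⟩ : ∃ J1, J1 ≤ j + 1 ∧ (ls → J1 = j + 1) ∧ (¬ ls → J1 ≤ j) ∧
      (¬ ls → (∀ a b, a ≠ i → b < j → E P a b → b < J1) ∧
      (∀ b0, b0 < j → E P i b0 → J1 ≤ b0 + 1)) := by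
    by_cases h : ls
    · exact ⟨j+1, le_rfl, fun _ => rfl, fun h' => absurd h h', fun h' => absurd h h'⟩
    · obtain ⟨J1, h1, h2, h3⟩ := ex_J1 (hnls h)
      exact ⟨J1, by omega, fun h' => absurd h' h, fun _ => h1, fun _ => ⟨h2, h3⟩⟩
  obtain ⟨J2, J2a, J2a', J2b, J2c, J2d⟩ : ∃ J2, j ≤ J2 ∧ J2 ≤ P.n ∧ (rt → J2 = j) ∧ (¬ rt → j < J2) ∧
      (¬ rt → (∀ a b, a ≠ i → j < b → E P a b → J2 ≤ b) ∧
      (∀ b0, j < b0 → E P i b0 → b0 ≤ J2)) := by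
    by_cases h : rt
    · exact ⟨j, le_rfl, hj.le, fun _ => rfl, fun h' => absurd h h', fun h' => absurd h h'⟩
    · obtain ⟨J2, h1, h1', h2, h3⟩ := ex_J2 hj (hnrt h)
      exact ⟨J2, by omega, h1', fun h' => absurd h' h, fun _ => h1, fun _ => ⟨h2, h3⟩⟩
  have fitS : ∀ a b, E P a b → ¬ (a = i ∧ b = j) → b < J1 → Fit R Rs a → 
      (b < J1 ∧ ∃ x y, R a ≤ x ∧ x < R (a+1) ∧ Cs b ≤ y ∧ (b + 1 < J1 → y < Cs (b+1)) ∧ y ≤ G 0 ∧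
        M.entry x y = true) := by
    intro a b hab hne hb hf
    rcases d.s.hE a b hab with h | ⟨x, y, h1, h2, h3, h4, h5⟩
    · exact absurd h hne
    · have := csj (b+1) (by omega)
      have := hf.1
      have := hf.2
      exact ⟨hb, x, y, by omega, by omega, h3, fun _ => h4, by omega, h5⟩
  have fitT : ∀ a b, E P a b → ¬ (a = i ∧ b = j) → J2 ≤ b → Fit R Rt a → 
      (J2 ≤ b ∧ ∃ x y, R a ≤ x ∧ x < R (a+1) ∧ (J2 < b → Ct b ≤ y) ∧ y < Ct (b+1) ∧
        G (2 * P.n + 2) ≤ y ∧ M.entry x y = true) := by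
    intro a b hab hne hb hf
    rcases d.t.hE a b hab with h | ⟨x, y, h1, h2, h3, h4, h5⟩
    · exact absurd h hne
    · have := ctj b (by omega) hab.2.1.le
      have := hf.1
      have := hf.2
      exact ⟨hb, x, y, by omega, by omega, fun _ => h3, h4, by omega, h5⟩
  refine core d.hi hj hR hRm hr1 hr2 J1a J2a J2a' d.hG ?_ d.hGe (Cs := Cs) (Ct := Ct)
    (fun b hb => d.s.hC b (by omega)) (fun b hb => csj b (by omega))
    (fun b _ hb => d.t.hC b hb) (fun b hb hb' => ctj b (by omega) hb') d.t.hn ?_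
  · have := ctj P.n hj.le le_rfl
    have := d.t.hn
    omega
  · intro a b hab
    by_cases hne : a = i ∧ b = j
    · exact Or.inl hne
    right
    rcases lt_trichotomy b j with hb | hb | hb
    · by_cases hai : a = i
      · subst hai
        by_cases h : ls
        · left; exact fitS _ _ hab hne (by have := J1b h; omega) (hls h b hb hab)
        · right; left; exact ⟨hb, (J1d h).2 b hb hab, rfl⟩
      · left
        refine fitS _ _ hab hne ?_ (hL a b hai hb hab)
        by_cases h : ls
        · have := J1b h; omega
        · exact (J1d h).1 a b hai hb hab
    · subst hb
      have hai : a ≠ i := fun h => hne ⟨h, rfl⟩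
      rcases hM a hai hab with ⟨h1, h2⟩ | ⟨h1, h2⟩
      · left; exact fitS _ _ hab hne (by have := J1b h1; omega) h2
      · right; right; left; exact fitT _ _ hab hne (by have := J2b h1; omega) h2
    · by_cases hai : a = i
      · subst hai
        by_cases h : rt
        · right; right; left; exact fitT _ _ hab hne (by have := J2b h; omega) (hrt h b hb hab)
        · right; right; right; exact ⟨hb, (J2d h).2 b hb hab, rfl⟩
      · right; right; left
        refine fitT _ _ hab hne ?_ (hRi a b hai hb hab)
        by_cases h : rt
        · have := J2b h; omega
        · exact (J2d h).1 a b hai hb hab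

end IM


namespace IM

/-- row cuts above row `i` -/
def Up (P : BMat) (i j r : ℕ) (Rs Rt : ℕ → ℕ) (mS mT : Prop) (A : ℕ → ℕ) : Prop :=
  (∀ a, a < i → A a < A (a+1)) ∧ A i ≤ r ∧ ∀ a b, a < i → E P a b →
    (b < j → Fit A Rs a) ∧ (j < b → Fit A Rt a) ∧
    (b = j → (mS ∧ Fit A Rs a) ∨ (mT ∧ Fit A Rt a))

/-- row cuts below row `i` -/
def Lo (P M : BMat) (i j r : ℕ) (Rs Rt : ℕ → ℕ) (mS mT : Prop) (B : ℕ → ℕ) : Prop :=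
  (∀ a, i < a → a < P.m → B a < B (a+1)) ∧ r < B (i+1) ∧ B P.m ≤ M.m ∧ ∀ a b, i < a → E P a b →
    (b < j → Fit B Rs a) ∧ (j < b → Fit B Rt a) ∧
    (b = j → (mS ∧ Fit B Rs a) ∨ (mT ∧ Fit B Rt a))

lemma combine {P M : BMat} {i j r : ℕ} {Rs Cs Rt Ct G : ℕ → ℕ} (d : Duo P M i j r Rs Cs Rt Ct G)
    {mS mT nS nT : Prop} {A B : ℕ → ℕ} (hA : Up P i j r Rs Rt mS mT A)
    (hB : Lo P M i j r Rs Rt nS nT B) (ls rt : Prop)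
    (hU : ∀ a, a < i → E P a j → (mS → ls) ∧ (mT → rt))
    (hD : ∀ a, i < a → E P a j → (nS → ls) ∧ (nT → rt))
    (hls : ls → ∀ b, b < j → E P i b → A i ≤ Rs i ∧ Rs (i+1) ≤ B (i+1))
    (hrt : rt → ∀ b, j < b → E P i b → A i ≤ Rt i ∧ Rt (i+1) ≤ B (i+1))
    (hnls : ¬ ls → ∀ b0, b0 < j → E P i b0 → ∀ a b, a ≠ i → b < j → E P a b → b ≤ b0)
    (hnrt : ¬ rt → ∀ b0, j < b0 → E P i b0 → ∀ a b, a ≠ i → j < b → E P a b → b0 ≤ b) :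
    PartitionContains M P := by
  have hi := d.hi
  obtain ⟨A1, A2, A3⟩ := hA
  obtain ⟨B1, B2, B3, B4⟩ := hB
  let R : ℕ → ℕ := fun a => if a ≤ i then A a else B a
  have RA : ∀ a, a ≤ i → R a = A a := fun a h => if_pos h
  have RB : ∀ a, i < a → R a = B a := fun a h => if_neg (by omega)
  have fA : ∀ X a, a < i → Fit A X a → Fit R X a := by
    intro X a ha h
    unfold Fit; rw [RA a ha.le, RA (a+1) (by omega)]; exact h
  have fB : ∀ X a, i < a → Fit B X a → Fit R X a := by
    intro X a ha h
    unfold Fit; rw [RB a ha, RB (a+1) (by omega)]; exact h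
  have fi : ∀ X, A i ≤ X i ∧ X (i+1) ≤ B (i+1) → Fit R X i := by
    intro X h
    unfold Fit; rw [RA i le_rfl, RB (i+1) (by omega)]; exact h
  refine final d (R := R) ?_ ?_ ?_ ?_ ls rt ?_ ?_ ?_ (fun h b hb e => fi _ (hls h b hb e))
    (fun h b hb e => fi _ (hrt h b hb e)) hnls hnrt
  · intro a ha
    rcases lt_trichotomy a i with h | h | h
    · rw [RA a h.le, RA (a+1) (by omega)]; exact A1 a h
    · subst h; rw [RA a le_rfl, RB (a+1) (by omega)]; omega
    · rw [RB a h, RB (a+1) (by omega)]; exact B1 a h ha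
  · rw [RB _ hi]; exact B3
  · rw [RA i le_rfl]; exact A2
  · rw [RB (i+1) (by omega)]; exact B2
  · intro a b ha hb hab
    rcases lt_or_gt_of_ne ha with h | h
    · exact fA _ _ h ((A3 a b h hab).1 hb)
    · exact fB _ _ h ((B4 a b h hab).1 hb)
  · intro a b ha hb hab
    rcases lt_or_gt_of_ne ha with h | h
    · exact fA _ _ h ((A3 a b h hab).2.1 hb)
    · exact fB _ _ h ((B4 a b h hab).2.1 hb)
  · intro a ha hab
    rcases lt_or_gt_of_ne ha with h | h
    · rcases (A3 a j h hab).2.2 rfl with q | q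
      · exact Or.inl ⟨(hU a h hab).1 q.1, fA _ _ h q.2⟩
      · exact Or.inr ⟨(hU a h hab).2 q.1, fA _ _ h q.2⟩
    · rcases (B4 a j h hab).2.2 rfl with q | q
      · exact Or.inl ⟨(hD a h hab).1 q.1, fB _ _ h q.2⟩
      · exact Or.inr ⟨(hD a h hab).2 q.1, fB _ _ h q.2⟩

/-- upper part from `s` -/
def UpS (P : BMat) (i j r : ℕ) (Rs Rt : ℕ → ℕ) : Prop :=
  ∃ A, Up P i j r Rs Rt True False A ∧ A i ≤ Rs i
/-- upper part from `t` -/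
def UpT (P : BMat) (i j r : ℕ) (Rs Rt : ℕ → ℕ) : Prop :=
  ∃ A, Up P i j r Rs Rt False True A ∧ A i ≤ Rt i
/-- lower part from `s` -/
def LoS (P M : BMat) (i j r : ℕ) (Rs Rt : ℕ → ℕ) : Prop :=
  ∃ A, Lo P M i j r Rs Rt True False A ∧ Rs (i+1) ≤ A (i+1)
/-- lower part from `t` -/
def LoT (P M : BMat) (i j r : ℕ) (Rs Rt : ℕ → ℕ) : Prop :=
  ∃ A, Lo P M i j r Rs Rt False True A ∧ Rt (i+1) ≤ A (i+1)

/-- condition on the left part of row `i` -/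
def LC (P : BMat) (i j : ℕ) : Prop :=
  ∀ b0, b0 < j → E P i b0 → ∀ a b, a ≠ i → b < j → E P a b → b ≤ b0
/-- condition on the right part of row `i` -/
def RC (P : BMat) (i j : ℕ) : Prop :=
  ∀ b0, j < b0 → E P i b0 → ∀ a b, a ≠ i → j < b → E P a b → b0 ≤ b

lemma modeS {P M : BMat} {i j r : ℕ} {Rs Cs Rt Ct G : ℕ → ℕ} (d : Duo P M i j r Rs Cs Rt Ct G)
    (hu : UpS P i j r Rs Rt) (hl : LoS P M i j r Rs Rt) (hrc : RC P i j) :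
    PartitionContains M P := by
  obtain ⟨A, hA, hA'⟩ := hu
  obtain ⟨B, hB, hB'⟩ := hl
  exact combine d hA hB True False (fun _ _ _ => ⟨id, id⟩) (fun _ _ _ => ⟨id, id⟩)
    (fun _ _ _ _ => ⟨hA', hB'⟩) (fun h => h.elim) (fun h => (h trivial).elim) (fun _ => hrc)

lemma modeT {P M : BMat} {i j r : ℕ} {Rs Cs Rt Ct G : ℕ → ℕ} (d : Duo P M i j r Rs Cs Rt Ct G)
    (hu : UpT P i j r Rs Rt) (hl : LoT P M i j r Rs Rt) (hlc : LC P i j) :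
    PartitionContains M P := by
  obtain ⟨A, hA, hA'⟩ := hu
  obtain ⟨B, hB, hB'⟩ := hl
  exact combine d hA hB False True (fun _ _ _ => ⟨id, id⟩) (fun _ _ _ => ⟨id, id⟩)
    (fun h => h.elim) (fun _ _ _ _ => ⟨hA', hB'⟩) (fun _ => hlc) (fun h => (h trivial).elim)

lemma modeST {P M : BMat} {i j r : ℕ} {Rs Cs Rt Ct G : ℕ → ℕ} (d : Duo P M i j r Rs Cs Rt Ct G)
    (hu : UpS P i j r Rs Rt) (hl : LoT P M i j r Rs Rt) (hlc : LC P i j) (hrc : RC P i j)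
    (h1 : ∀ a b, a < i → E P a j → b < j → E P i b → False)
    (h2 : ∀ a b, i < a → E P a j → j < b → E P i b → False) :
    PartitionContains M P := by
  obtain ⟨A, hA, hA'⟩ := hu
  obtain ⟨B, hB, hB'⟩ := hl
  exact combine d hA hB (∀ b, b < j → E P i b → False) (∀ b, j < b → E P i b → False)
    (fun a ha e => ⟨fun _ b hb e' => h1 a b ha e hb e', False.elim⟩)
    (fun a ha e => ⟨False.elim, fun _ b hb e' => h2 a b ha e hb e'⟩)
    (fun h b hb e => (h b hb e).elim) (fun h b hb e => (h b hb e).elim)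
    (fun _ => hlc) (fun _ => hrc)

lemma modeTS {P M : BMat} {i j r : ℕ} {Rs Cs Rt Ct G : ℕ → ℕ} (d : Duo P M i j r Rs Cs Rt Ct G)
    (hu : UpT P i j r Rs Rt) (hl : LoS P M i j r Rs Rt) (hlc : LC P i j) (hrc : RC P i j)
    (h1 : ∀ a b, a < i → E P a j → j < b → E P i b → False)
    (h2 : ∀ a b, i < a → E P a j → b < j → E P i b → False) :
    PartitionContains M P := by
  obtain ⟨A, hA, hA'⟩ := hu
  obtain ⟨B, hB, hB'⟩ := hl
  exact combine d hA hB (∀ b, b < j → E P i b → False) (∀ b, j < b → E P i b → False)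
    (fun a ha e => ⟨False.elim, fun _ b hb e' => h1 a b ha e hb e'⟩)
    (fun a ha e => ⟨fun _ b hb e' => h2 a b ha e hb e', False.elim⟩)
    (fun h b hb e => (h b hb e).elim) (fun h b hb e => (h b hb e).elim)
    (fun _ => hlc) (fun _ => hrc)

lemma modeX {P M : BMat} {i j r : ℕ} {Rs Cs Rt Ct G : ℕ → ℕ} (d : Duo P M i j r Rs Cs Rt Ct G)
    (hu : ∃ A, Up P i j r Rs Rt True True A) (hl : ∃ B, Lo P M i j r Rs Rt True True B)
    (hL : ∀ b, b < j → E P i b → False) (hR : ∀ b, j < b → E P i b → False) :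
    PartitionContains M P := by
  obtain ⟨A, hA⟩ := hu
  obtain ⟨B, hB⟩ := hl
  exact combine d hA hB True True (fun _ _ _ => ⟨id, id⟩) (fun _ _ _ => ⟨id, id⟩)
    (fun _ b hb e => (hL b hb e).elim) (fun _ b hb e => (hR b hb e).elim)
    (fun h => (h trivial).elim) (fun h => (h trivial).elim)

section
variable {P M : BMat} {i j r : ℕ} {Rs Cs Rt Ct G : ℕ → ℕ}

lemma fit_self (X : ℕ → ℕ) (a : ℕ) : Fit X X a := ⟨le_rfl, le_rfl⟩

lemma upS_of (d : Duo P M i j r Rs Cs Rt Ct G) (h : ∀ a b, a < i → j < b → E P a b → False) :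
    UpS P i j r Rs Rt := by
  have hi := d.hi
  exact ⟨Rs, ⟨fun a ha => d.s.hR a (by omega), d.s.r1, fun a b ha e => ⟨fun _ => fit_self _ _,
    fun hb => (h a b ha hb e).elim, fun _ => Or.inl ⟨trivial, fit_self _ _⟩⟩⟩, le_rfl⟩

lemma upT_of (d : Duo P M i j r Rs Cs Rt Ct G) (h : ∀ a b, a < i → b < j → E P a b → False) :
    UpT P i j r Rs Rt := by
  have hi := d.hi
  exact ⟨Rt, ⟨fun a ha => d.t.hR a (by omega), d.t.r1, fun a b ha e =>
    ⟨fun hb => (h a b ha hb e).elim, fun _ => fit_self _ _,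
      fun _ => Or.inr ⟨trivial, fit_self _ _⟩⟩⟩, le_rfl⟩

lemma loS_of (d : Duo P M i j r Rs Cs Rt Ct G) (h : ∀ a b, i < a → j < b → E P a b → False) :
    LoS P M i j r Rs Rt :=
  ⟨Rs, ⟨fun a _ ha => d.s.hR a (by omega), d.s.r2, d.s.hm, fun a b ha e => ⟨fun _ => fit_self _ _,
    fun hb => (h a b ha hb e).elim, fun _ => Or.inl ⟨trivial, fit_self _ _⟩⟩⟩, le_rfl⟩

lemma loT_of (d : Duo P M i j r Rs Cs Rt Ct G) (h : ∀ a b, i < a → b < j → E P a b → False) :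
    LoT P M i j r Rs Rt :=
  ⟨Rt, ⟨fun a _ ha => d.t.hR a (by omega), d.t.r2, d.t.hm, fun a b ha e =>
    ⟨fun hb => (h a b ha hb e).elim, fun _ => fit_self _ _,
      fun _ => Or.inr ⟨trivial, fit_self _ _⟩⟩⟩, le_rfl⟩

/-- the generic upper cuts: identity down to row `i'` and `X` afterwards -/
lemma up_aux {i' : ℕ} (hi' : i' < i) (hi : i < P.m) {X : ℕ → ℕ}
    (hX : ∀ a, a < P.m → X a < X (a+1)) :
    ∃ A : ℕ → ℕ, (∀ a, a < i → A a < A (a+1)) ∧ A i = X i ∧ (∀ a, i' < a → Fit A X a) ∧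
      ∀ Y : ℕ → ℕ, (∀ a, a < P.m → Y a < Y (a+1)) → Y (i'+1) ≤ X (i'+1) → Fit A Y i' := by
  have X0 := fun a h => strict_le hX 0 a (by omega) h
  let A : ℕ → ℕ := fun a => if a ≤ i' then a else X a
  have A1 : ∀ a, a ≤ i' → A a = a := fun a h => if_pos h
  have A2 : ∀ a, i' < a → A a = X a := fun a h => if_neg (by omega)
  refine ⟨A, ?_, A2 i hi', ?_, ?_⟩
  · intro a ha
    rcases lt_trichotomy a i' with h | h | h
    · rw [A1 a h.le, A1 (a+1) (by omega)]; omega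
    · rw [A1 a h.le, A2 (a+1) (by omega)]
      have := X0 (a+1) (by omega); omega
    · rw [A2 a h, A2 (a+1) (by omega)]; exact hX a (by omega)
  · intro a ha
    unfold Fit; rw [A2 a ha, A2 (a+1) (by omega)]; exact ⟨le_rfl, le_rfl⟩
  · intro Y hY hYX
    have := strict_le hY 0 i' (by omega) (by omega)
    unfold Fit; rw [A1 i' le_rfl, A2 (i'+1) (by omega)]
    exact ⟨by omega, hYX⟩

/-- the generic lower cuts -/
lemma lo_aux {i' : ℕ} (hi' : i < i') (hi : i' < P.m) {X : ℕ → ℕ}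
    (hX : ∀ a, a < P.m → X a < X (a+1)) (hXm : X P.m ≤ M.m) :
    ∃ B : ℕ → ℕ, (∀ a, i < a → a < P.m → B a < B (a+1)) ∧ B (i+1) = X (i+1) ∧ B P.m ≤ M.m ∧
      (∀ a, a < i' → Fit B X a) ∧
      ∀ Y : ℕ → ℕ, (∀ a, a < P.m → Y a < Y (a+1)) → Y P.m ≤ M.m → X i' ≤ Y i' → Fit B Y i' := by
  have X0 := fun a h => strict_le hX a P.m h le_rfl
  let B : ℕ → ℕ := fun a => if a ≤ i' then X a else M.m - (P.m - a)
  have B1 : ∀ a, a ≤ i' → B a = X a := fun a h => if_pos h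
  have B2 : ∀ a, i' < a → B a = M.m - (P.m - a) := fun a h => if_neg (by omega)
  refine ⟨B, ?_, B1 _ (by omega), ?_, ?_, ?_⟩
  · intro a _ ha
    have := X0 a ha.le
    rcases lt_trichotomy a i' with h | h | h
    · rw [B1 a h.le, B1 (a+1) (by omega)]; exact hX a ha
    · rw [B1 a h.le, B2 (a+1) (by omega)]; omega
    · rw [B2 a h, B2 (a+1) (by omega)]; omega
  · rw [B2 _ hi]; omega
  · intro a ha
    unfold Fit; rw [B1 a ha.le, B1 (a+1) (by omega)]; exact ⟨le_rfl, le_rfl⟩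
  · intro Y hY hYm hYX
    have := strict_le hY (i'+1) P.m (by omega) (by omega)
    unfold Fit; rw [B1 i' le_rfl, B2 (i'+1) (by omega)]
    exact ⟨hYX, by omega⟩

lemma up_row (d : Duo P M i j r Rs Cs Rt Ct G) {i' : ℕ} (hi' : i' < i)
    (h : ∀ a b, a < i → b ≠ j → E P a b → a = i') (h' : ∀ a, a < i → E P a j → i' ≤ a) :
    UpS P i j r Rs Rt ∨ UpT P i j r Rs Rt := by
  have hi := d.hi
  rcases le_total (Rt (i'+1)) (Rs (i'+1)) with q | q
  · left
    obtain ⟨A, h1, h2, h3, h4⟩ := up_aux hi' hi d.s.hR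
    have fs := h4 Rs d.s.hR le_rfl
    have ft := h4 Rt d.t.hR q
    refine ⟨A, ⟨h1, by rw [h2]; exact d.s.r1, ?_⟩, h2.le⟩
    intro a b ha e
    refine ⟨fun hb => ?_, fun hb => ?_, fun hb => Or.inl ⟨trivial, ?_⟩⟩
    · rw [h a b ha (by omega) e]; exact fs
    · rw [h a b ha (by omega) e]; exact ft
    · subst hb
      rcases (h' a ha e).lt_or_eq with w | w
      · exact h3 a w
      · rw [← w]; exact fs
  · right
    obtain ⟨A, h1, h2, h3, h4⟩ := up_aux hi' hi d.t.hR
    have fs := h4 Rs d.s.hR q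
    have ft := h4 Rt d.t.hR le_rfl
    refine ⟨A, ⟨h1, by rw [h2]; exact d.t.r1, ?_⟩, h2.le⟩
    intro a b ha e
    refine ⟨fun hb => ?_, fun hb => ?_, fun hb => Or.inr ⟨trivial, ?_⟩⟩
    · rw [h a b ha (by omega) e]; exact fs
    · rw [h a b ha (by omega) e]; exact ft
    · subst hb
      rcases (h' a ha e).lt_or_eq with w | w
      · exact h3 a w
      · rw [← w]; exact ft

lemma lo_row (d : Duo P M i j r Rs Cs Rt Ct G) {i' : ℕ} (hi' : i < i') (hi : i' < P.m)
    (h : ∀ a b, i < a → b ≠ j → E P a b → a = i') (h' : ∀ a, i < a → E P a j → a ≤ i') :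
    LoS P M i j r Rs Rt ∨ LoT P M i j r Rs Rt := by
  rcases le_total (Rs i') (Rt i') with q | q
  · left
    obtain ⟨A, h1, h2, h2', h3, h4⟩ := lo_aux hi' hi d.s.hR d.s.hm
    have fs := h4 Rs d.s.hR d.s.hm le_rfl
    have ft := h4 Rt d.t.hR d.t.hm q
    refine ⟨A, ⟨h1, by rw [h2]; exact d.s.r2, h2', ?_⟩, h2.ge⟩
    intro a b ha e
    refine ⟨fun hb => ?_, fun hb => ?_, fun hb => Or.inl ⟨trivial, ?_⟩⟩
    · rw [h a b ha (by omega) e]; exact fs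
    · rw [h a b ha (by omega) e]; exact ft
    · subst hb
      rcases (h' a ha e).lt_or_eq with w | w
      · exact h3 a w
      · rw [w]; exact fs
  · right
    obtain ⟨A, h1, h2, h2', h3, h4⟩ := lo_aux hi' hi d.t.hR d.t.hm
    have fs := h4 Rs d.s.hR d.s.hm q
    have ft := h4 Rt d.t.hR d.t.hm le_rfl
    refine ⟨A, ⟨h1, by rw [h2]; exact d.t.r2, h2', ?_⟩, h2.ge⟩
    intro a b ha e
    refine ⟨fun hb => ?_, fun hb => ?_, fun hb => Or.inr ⟨trivial, ?_⟩⟩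
    · rw [h a b ha (by omega) e]; exact fs
    · rw [h a b ha (by omega) e]; exact ft
    · subst hb
      rcases (h' a ha e).lt_or_eq with w | w
      · exact h3 a w
      · rw [w]; exact ft

/-- cross cuts at row `i'` -/
lemma cross (hs : ∀ a, a < P.m → Rs a < Rs (a+1)) (ht : ∀ a, a < P.m → Rt a < Rt (a+1))
    {i' : ℕ} (hi' : i' < P.m) :
    ∃ A : ℕ → ℕ, (∀ a, a < P.m → A a < A (a+1)) ∧ Fit A Rs i' ∧ Fit A Rt i' ∧
      (∀ a, a ≠ i' → Fit A Rs a ∨ Fit A Rt a) ∧ 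
      (∀ a, a ≤ i' → A a ≤ max (Rs a) (Rt a) ∧ min (Rs a) (Rt a) ≤ A a) ∧
      (∀ a, i' < a → A a ≤ max (Rs a) (Rt a) ∧ min (Rs a) (Rt a) ≤ A a) := by
  obtain ⟨X, hX, hX1, hX2, hX3⟩ : ∃ X : ℕ → ℕ, (∀ a, a < P.m → X a < X (a+1)) ∧ X i' ≤ Rs i' ∧
      X i' ≤ Rt i' ∧ (X = Rs ∨ X = Rt) := by
    rcases le_total (Rs i') (Rt i') with q | q
    · exact ⟨Rs, hs, le_rfl, q, Or.inl rfl⟩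
    · exact ⟨Rt, ht, q, le_rfl, Or.inr rfl⟩
  obtain ⟨Y, hY, hY1, hY2, hY3⟩ : ∃ X : ℕ → ℕ, (∀ a, a < P.m → X a < X (a+1)) ∧
      Rs (i'+1) ≤ X (i'+1) ∧ Rt (i'+1) ≤ X (i'+1) ∧ (X = Rs ∨ X = Rt) := by
    rcases le_total (Rt (i'+1)) (Rs (i'+1)) with q | q
    · exact ⟨Rs, hs, le_rfl, q, Or.inl rfl⟩
    · exact ⟨Rt, ht, q, le_rfl, Or.inr rfl⟩
  let A : ℕ → ℕ := fun a => if a ≤ i' then X a else Y a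
  have A1 : ∀ a, a ≤ i' → A a = X a := fun a h => if_pos h
  have A2 : ∀ a, i' < a → A a = Y a := fun a h => if_neg (by omega)
  refine ⟨A, ?_, ?_, ?_, ?_, ?_, ?_⟩
  · intro a ha
    rcases lt_trichotomy a i' with h | h | h
    · rw [A1 a h.le, A1 (a+1) (by omega)]; exact hX a ha
    · subst h
      rw [A1 a le_rfl, A2 (a+1) (by omega)]
      have := hs a ha; omega
    · rw [A2 a h, A2 (a+1) (by omega)]; exact hY a ha
  · unfold Fit; rw [A1 i' le_rfl, A2 (i'+1) (by omega)]; exact ⟨hX1, hY1⟩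
  · unfold Fit; rw [A1 i' le_rfl, A2 (i'+1) (by omega)]; exact ⟨hX2, hY2⟩
  · intro a ha
    unfold Fit
    rcases lt_or_gt_of_ne ha with h | h
    · rw [A1 a h.le, A1 (a+1) (by omega)]
      rcases hX3 with w | w
      · left; rw [w]; exact ⟨le_rfl, le_rfl⟩
      · right; rw [w]; exact ⟨le_rfl, le_rfl⟩
    · rw [A2 a h, A2 (a+1) (by omega)]
      rcases hY3 with w | w
      · left; rw [w]; exact ⟨le_rfl, le_rfl⟩
      · right; rw [w]; exact ⟨le_rfl, le_rfl⟩
  · intro a h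
    rw [A1 a h]; rcases hX3 with w | w <;> rw [w] <;> constructor <;> simp
  · intro a h
    rw [A2 a h]; rcases hY3 with w | w <;> rw [w] <;> constructor <;> simp

lemma upX_row (d : Duo P M i j r Rs Cs Rt Ct G) {i' : ℕ} (hi' : i' < i)
    (h : ∀ a b, a < i → b ≠ j → E P a b → a = i') : ∃ A, Up P i j r Rs Rt True True A := by
  have hi := d.hi
  obtain ⟨A, h1, h2, h3, h4, h5, h6⟩ := cross d.s.hR d.t.hR (show i' < P.m by omega)
  refine ⟨A, fun a ha => h1 a (by omega), ?_, ?_⟩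
  · have := (h6 i hi').1
    have := d.s.r1
    have := d.t.r1
    omega
  · intro a b ha e
    refine ⟨fun hb => ?_, fun hb => ?_, fun hb => ?_⟩
    · rw [h a b ha (by omega) e]; exact h2
    · rw [h a b ha (by omega) e]; exact h3
    · by_cases w : a = i'
      · rw [w]; exact Or.inl ⟨trivial, h2⟩
      · exact (h4 a w).imp (fun h => ⟨trivial, h⟩) (fun h => ⟨trivial, h⟩)

lemma loX_row (d : Duo P M i j r Rs Cs Rt Ct G) {i' : ℕ} (hi' : i < i') (hi : i' < P.m)
    (h : ∀ a b, i < a → b ≠ j → E P a b → a = i') : ∃ A, Lo P M i j r Rs Rt True True A := by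
  obtain ⟨A, h1, h2, h3, h4, h5, h6⟩ := cross d.s.hR d.t.hR hi
  refine ⟨A, fun a _ ha => h1 a (by omega), ?_, ?_, ?_⟩
  · have := (h5 (i+1) hi').2
    have := d.s.r2
    have := d.t.r2
    omega
  · have := (h6 P.m hi).1
    have := d.s.hm
    have := d.t.hm
    omega
  · intro a b ha e
    refine ⟨fun hb => ?_, fun hb => ?_, fun hb => ?_⟩
    · rw [h a b ha (by omega) e]; exact h2
    · rw [h a b ha (by omega) e]; exact h3
    · by_cases w : a = i'
      · rw [w]; exact Or.inl ⟨trivial, h2⟩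
      · exact (h4 a w).imp (fun h => ⟨trivial, h⟩) (fun h => ⟨trivial, h⟩)

lemma upS_X (h : UpS P i j r Rs Rt) : ∃ A, Up P i j r Rs Rt True True A := by
  obtain ⟨A, ⟨h1, h2, h3⟩, _⟩ := h
  exact ⟨A, h1, h2, fun a b ha e => ⟨(h3 a b ha e).1, (h3 a b ha e).2.1, fun hb =>
    ((h3 a b ha e).2.2 hb).imp id (fun h => h.1.elim)⟩⟩

lemma upT_X (h : UpT P i j r Rs Rt) : ∃ A, Up P i j r Rs Rt True True A := by
  obtain ⟨A, ⟨h1, h2, h3⟩, _⟩ := h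
  exact ⟨A, h1, h2, fun a b ha e => ⟨(h3 a b ha e).1, (h3 a b ha e).2.1, fun hb =>
    ((h3 a b ha e).2.2 hb).imp (fun h => h.1.elim) id⟩⟩

lemma loS_X (h : LoS P M i j r Rs Rt) : ∃ A, Lo P M i j r Rs Rt True True A := by
  obtain ⟨A, ⟨h1, h2, h2', h3⟩, _⟩ := h
  exact ⟨A, h1, h2, h2', fun a b ha e => ⟨(h3 a b ha e).1, (h3 a b ha e).2.1, fun hb =>
    ((h3 a b ha e).2.2 hb).imp id (fun h => h.1.elim)⟩⟩

lemma loT_X (h : LoT P M i j r Rs Rt) : ∃ A, Lo P M i j r Rs Rt True True A := by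
  obtain ⟨A, ⟨h1, h2, h2', h3⟩, _⟩ := h
  exact ⟨A, h1, h2, h2', fun a b ha e => ⟨(h3 a b ha e).1, (h3 a b ha e).2.1, fun hb =>
    ((h3 a b ha e).2.2 hb).imp (fun h => h.1.elim) id⟩⟩

end

end IM


namespace IM

lemma n3 {P : BMat} (h : NoQ P) (a0 b0 a1 b1 a2 b2 : ℕ) (e0 : E P a0 b0) (e1 : E P a1 b1)
    (e2 : E P a2 b2) (h1 : a0 < a1) (h2 : a1 < a2) :
    b0 = b1 ∨ b1 = b2 ∨ b0 = b2 ∨ (b0 < b1 ∧ b1 < b2) ∨ (b2 < b1 ∧ b1 < b0) :=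
  h a0 b0 a1 b1 a2 b2 h1 h2 e2.1 e0.2.1 e1.2.1 e2.2.1 e0.2.2 e1.2.2 e2.2.2

/-- all 1-entries in two rows -/
def TR (P : BMat) (i : ℕ) : Prop := ∃ i', i' < P.m ∧ i' ≠ i ∧ ∀ a b, E P a b → a = i ∨ a = i'

lemma tr_of {P : BMat} (h : NoQ P) {i j a p q v : ℕ} (hij : E P i j) (h1 : E P i v) (h2 : E P a p)
    (h3 : E P a q) (ha : a ≠ i) (hp : p < j) (hq : j < q) (hv : v < p ∨ q < v) : TR P i := by
  refine ⟨a, h2.1, ha, fun x y e => ?_⟩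
  by_contra hx
  push Not at hx
  obtain ⟨hx1, hx2⟩ := hx
  rcases lt_or_gt_of_ne ha with w | w
  · rcases lt_or_gt_of_ne hx2 with w2 | w2
    · have := n3 h _ _ _ _ _ _ e h2 h1 w2 w
      have := n3 h _ _ _ _ _ _ e h3 h1 w2 w
      have := n3 h _ _ _ _ _ _ e h2 hij w2 w
      have := n3 h _ _ _ _ _ _ e h3 hij w2 w
      omega
    · rcases lt_or_gt_of_ne hx1 with w1 | w1
      · have := n3 h _ _ _ _ _ _ h2 e h1 w2 w1
        have := n3 h _ _ _ _ _ _ h3 e h1 w2 w1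
        have := n3 h _ _ _ _ _ _ h2 e hij w2 w1
        have := n3 h _ _ _ _ _ _ h3 e hij w2 w1
        omega
      · have := n3 h _ _ _ _ _ _ h2 h1 e w w1
        have := n3 h _ _ _ _ _ _ h3 h1 e w w1
        have := n3 h _ _ _ _ _ _ h2 hij e w w1
        have := n3 h _ _ _ _ _ _ h3 hij e w w1
        omega
  · rcases lt_or_gt_of_ne hx1 with w1 | w1
    · have := n3 h _ _ _ _ _ _ e h1 h2 w1 w
      have := n3 h _ _ _ _ _ _ e h1 h3 w1 w
      have := n3 h _ _ _ _ _ _ e hij h2 w1 w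
      have := n3 h _ _ _ _ _ _ e hij h3 w1 w
      omega
    · rcases lt_or_gt_of_ne hx2 with w2 | w2
      · have := n3 h _ _ _ _ _ _ h1 e h2 w1 w2
        have := n3 h _ _ _ _ _ _ h1 e h3 w1 w2
        have := n3 h _ _ _ _ _ _ hij e h2 w1 w2
        have := n3 h _ _ _ _ _ _ hij e h3 w1 w2
        omega
      · have := n3 h _ _ _ _ _ _ h1 h2 e w w2
        have := n3 h _ _ _ _ _ _ h1 h3 e w w2
        have := n3 h _ _ _ _ _ _ hij h2 e w w2
        have := n3 h _ _ _ _ _ _ hij h3 e w w2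
        omega

/-- left and right quadrant entries on the same side of row `i` share their row -/
lemma up_same {P : BMat} (h : NoQ P) {i j a p a' q : ℕ} (hij : E P i j) (h1 : E P a p)
    (h2 : E P a' q) (ha : a < i) (ha' : a' < i) (hp : p < j) (hq : j < q) : a = a' := by
  rcases lt_trichotomy a a' with w | w | w
  · have := n3 h _ _ _ _ _ _ h1 h2 hij w ha'; omega
  · exact w
  · have := n3 h _ _ _ _ _ _ h2 h1 hij w ha; omega

lemma lo_same {P : BMat} (h : NoQ P) {i j a p a' q : ℕ} (hij : E P i j) (h1 : E P a p)
    (h2 : E P a' q) (ha : i < a) (ha' : i < a') (hp : p < j) (hq : j < q) : a = a' := by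
  rcases lt_trichotomy a a' with w | w | w
  · have := n3 h _ _ _ _ _ _ hij h1 h2 ha w; omega
  · exact w
  · have := n3 h _ _ _ _ _ _ hij h2 h1 ha' w; omega

lemma cases_lemma {P M : BMat} {i j r : ℕ} {Rs Cs Rt Ct G : ℕ → ℕ}
    (d : Duo P M i j r Rs Cs Rt Ct G) (hQ : NoQ P) (hij : E P i j) (htr : ¬ TR P i) :
    PartitionContains M P := by
  by_cases hl : ∃ a b, a ≠ i ∧ b < j ∧ E P a b
  swap
  · have hl' : ∀ a b, a ≠ i → b < j → E P a b → False := fun a b h1 h2 h3 => hl ⟨a, b, h1, h2, h3⟩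
    exact modeT d (upT_of d fun a b ha hb e => hl' a b (by omega) hb e)
      (loT_of d fun a b ha hb e => hl' a b (by omega) hb e)
      (fun _ _ _ a b ha hb e => (hl' a b ha hb e).elim)
  by_cases hr : ∃ a b, a ≠ i ∧ j < b ∧ E P a b
  swap
  · have hr' : ∀ a b, a ≠ i → j < b → E P a b → False := fun a b h1 h2 h3 => hr ⟨a, b, h1, h2, h3⟩
    exact modeS d (upS_of d fun a b ha hb e => hr' a b (by omega) hb e)
      (loS_of d fun a b ha hb e => hr' a b (by omega) hb e)
      (fun _ _ _ a b ha hb e => (hr' a b ha hb e).elim)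
  obtain ⟨a1, b1, ha1, hb1, e1⟩ := hl
  obtain ⟨a2, b2, ha2, hb2, e2⟩ := hr
  have hlc : LC P i j := by
    intro b0 hb0 e0 a b ha hb e
    by_contra hcon
    apply htr
    have : a2 = a := by
      rcases lt_or_gt_of_ne ha with w | w <;> rcases lt_or_gt_of_ne ha2 with w2 | w2
      · exact (up_same hQ hij e e2 w w2 hb hb2).symm
      · have := n3 hQ _ _ _ _ _ _ e e0 e2 w w2; omega
      · have := n3 hQ _ _ _ _ _ _ e2 e0 e w2 w; omega
      · exact (lo_same hQ hij e e2 w w2 hb hb2).symm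
    subst this
    exact tr_of hQ hij e0 e e2 ha hb hb2 (by omega)
  have hrc : RC P i j := by
    intro b0 hb0 e0 a b ha hb e
    by_contra hcon
    apply htr
    have : a1 = a := by
      rcases lt_or_gt_of_ne ha with w | w <;> rcases lt_or_gt_of_ne ha1 with w2 | w2
      · exact (up_same hQ hij e1 e w2 w hb1 hb)
      · have := n3 hQ _ _ _ _ _ _ e e0 e1 w w2; omega
      · have := n3 hQ _ _ _ _ _ _ e1 e0 e w2 w; omega
      · exact (lo_same hQ hij e1 e w2 w hb1 hb)
    subst this
    exact tr_of hQ hij e0 e1 e ha hb1 hb (by omega)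
  have hup : (∀ a b, a < i → j < b → E P a b → False) ∨ (∀ a b, a < i → b < j → E P a b → False) ∨
      ∃ i' p q, i' < i ∧ p < j ∧ j < q ∧ E P i' p ∧ E P i' q ∧
        ∀ a b, a < i → b ≠ j → E P a b → a = i' := by
    by_cases h1 : ∃ a b, a < i ∧ j < b ∧ E P a b
    swap
    · left; exact fun a b ha hb e => h1 ⟨a, b, ha, hb, e⟩
    by_cases h2 : ∃ a b, a < i ∧ b < j ∧ E P a b
    swap
    · right; left; exact fun a b ha hb e => h2 ⟨a, b, ha, hb, e⟩
    right; right
    obtain ⟨a, q, ha, hq, e⟩ := h1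
    obtain ⟨a', p, ha', hp, e'⟩ := h2
    have := up_same hQ hij e' e ha' ha hp hq
    subst this
    refine ⟨a', p, q, ha, hp, hq, e', e, ?_⟩
    intro x y hx hy exy
    rcases lt_or_gt_of_ne hy with w | w
    · exact up_same hQ hij exy e hx ha w hq
    · exact (up_same hQ hij e' exy ha hx hp w).symm
  have hlo : (∀ a b, i < a → j < b → E P a b → False) ∨ (∀ a b, i < a → b < j → E P a b → False) ∨
      ∃ i' p q, i < i' ∧ p < j ∧ j < q ∧ E P i' p ∧ E P i' q ∧
        ∀ a b, i < a → b ≠ j → E P a b → a = i' := by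
    by_cases h1 : ∃ a b, i < a ∧ j < b ∧ E P a b
    swap
    · left; exact fun a b ha hb e => h1 ⟨a, b, ha, hb, e⟩
    by_cases h2 : ∃ a b, i < a ∧ b < j ∧ E P a b
    swap
    · right; left; exact fun a b ha hb e => h2 ⟨a, b, ha, hb, e⟩
    right; right
    obtain ⟨a, q, ha, hq, e⟩ := h1
    obtain ⟨a', p, ha', hp, e'⟩ := h2
    have := lo_same hQ hij e' e ha' ha hp hq
    subst this
    refine ⟨a', p, q, ha, hp, hq, e', e, ?_⟩
    intro x y hx hy exy
    rcases lt_or_gt_of_ne hy with w | w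
    · exact lo_same hQ hij exy e hx ha w hq
    · exact (lo_same hQ hij e' exy ha hx hp w).symm
  by_cases hLR : ∃ v, v ≠ j ∧ E P i v
  swap
  · have hLR' : ∀ v, v ≠ j → E P i v → False := fun v h1 h2 => hLR ⟨v, h1, h2⟩
    refine modeX d ?_ ?_ (fun b hb e => hLR' b (by omega) e) (fun b hb e => hLR' b (by omega) e)
    · rcases hup with h | h | ⟨i', p, q, h1, h2, h3, h4, h5, h6⟩
      · exact upS_X (upS_of d h)
      · exact upT_X (upT_of d h)
      · exact upX_row d h1 h6
    · rcases hlo with h | h | ⟨i', p, q, h1, h2, h3, h4, h5, h6⟩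
      · exact loS_X (loS_of d h)
      · exact loT_X (loT_of d h)
      · exact loX_row d h1 h4.1 h6
  obtain ⟨v, hv, ev⟩ := hLR
  have hup' : UpS P i j r Rs Rt ∨ UpT P i j r Rs Rt := by
    rcases hup with h | h | ⟨i', p, q, h1, h2, h3, h4, h5, h6⟩
    · exact Or.inl (upS_of d h)
    · exact Or.inr (upT_of d h)
    · refine up_row d h1 h6 ?_
      intro a ha e
      by_contra hcon
      have := n3 hQ _ _ _ _ _ _ e h4 ev (by omega) h1
      have := n3 hQ _ _ _ _ _ _ e h5 ev (by omega) h1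
      omega
  have hlo' : LoS P M i j r Rs Rt ∨ LoT P M i j r Rs Rt := by
    rcases hlo with h | h | ⟨i', p, q, h1, h2, h3, h4, h5, h6⟩
    · exact Or.inl (loS_of d h)
    · exact Or.inr (loT_of d h)
    · refine lo_row d h1 h4.1 h6 ?_
      intro a ha e
      by_contra hcon
      have := n3 hQ _ _ _ _ _ _ ev h4 e h1 (by omega)
      have := n3 hQ _ _ _ _ _ _ ev h5 e h1 (by omega)
      omega
  rcases hup' with hu | hu <;> rcases hlo' with hd | hd
  · exact modeS d hu hd hrc
  · by_cases c1 : ∃ a b, a < i ∧ E P a j ∧ b < j ∧ E P i b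
    · obtain ⟨a, b, h1, h2, h3, h4⟩ := c1
      refine modeS d hu (loS_of d fun x y hx hy e => ?_) hrc
      have := n3 hQ _ _ _ _ _ _ h2 h4 e h1 hx
      omega
    by_cases c2 : ∃ a b, i < a ∧ E P a j ∧ j < b ∧ E P i b
    · obtain ⟨a, b, h1, h2, h3, h4⟩ := c2
      refine modeT d (upT_of d fun x y hx hy e => ?_) hd hlc
      have := n3 hQ _ _ _ _ _ _ e h4 h2 hx h1
      omega
    exact modeST d hu hd hlc hrc (fun a b h1 h2 h3 h4 => c1 ⟨a, b, h1, h2, h3, h4⟩)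
      (fun a b h1 h2 h3 h4 => c2 ⟨a, b, h1, h2, h3, h4⟩)
  · by_cases c1 : ∃ a b, a < i ∧ E P a j ∧ j < b ∧ E P i b
    · obtain ⟨a, b, h1, h2, h3, h4⟩ := c1
      refine modeT d hu (loT_of d fun x y hx hy e => ?_) hlc
      have := n3 hQ _ _ _ _ _ _ h2 h4 e h1 hx
      omega
    by_cases c2 : ∃ a b, i < a ∧ E P a j ∧ b < j ∧ E P i b
    · obtain ⟨a, b, h1, h2, h3, h4⟩ := c2
      refine modeS d (upS_of d fun x y hx hy e => ?_) hd hrc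
      have := n3 hQ _ _ _ _ _ _ e h4 h2 hx h1
      omega
    exact modeTS d hu hd hlc hrc (fun a b h1 h2 h3 h4 => c1 ⟨a, b, h1, h2, h3, h4⟩)
      (fun a b h1 h2 h3 h4 => c2 ⟨a, b, h1, h2, h3, h4⟩)
  · exact modeT d hu hd hlc

end IM


namespace IM

/-- A long family of embeddings. -/
structure Fam (P M : BMat) (i j r N : ℕ) (R C : ℕ → ℕ → ℕ) (g : ℕ → ℕ) : Prop where
  e : E P i j
  emb : ∀ t, t < N → Emb P M i j r (R t) (C t)
  g1 : ∀ t, t + 1 < N → C t (j+1) ≤ g t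
  g2 : ∀ t, t + 1 < N → g t < C (t+1) j
  ge : ∀ t, t + 1 < N → M.entry r (g t) = true

variable {P M : BMat} {i j r N : ℕ} {R C : ℕ → ℕ → ℕ} {g : ℕ → ℕ}

lemma Fam.gs (F : Fam P M i j r N R C g) : ∀ t, t < N - 2 → g t < g (t+1) := by
  intro t ht
  have := F.g2 t (by omega)
  have := F.g1 (t+1) (by omega)
  have := (F.emb (t+1) (by omega)).hC j F.e.2.1
  omega

lemma two_claim (F : Fam P M i j r N R C g) {i' : ℕ} (hii : i' ≠ i)
    (htr : ∀ a b, E P a b → a = i ∨ a = i') (hM : ¬ PartitionContains M P) {t : ℕ}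
    (ht : 2 * P.n + 3 ≤ t) (htN : t < N) :
    ∃ x y, R t i' ≤ x ∧ x < R t (i'+1) ∧ g (t - (2 * P.n + 3)) < y ∧ y < C t j ∧
      M.entry x y = true := by
  classical
  by_contra hcon
  apply hM
  have em := F.emb t htN
  have hj := F.e.2.1
  have hi := F.e.1
  obtain ⟨u, hu⟩ : ∃ u, u = t - (2 * P.n + 3) := ⟨_, rfl⟩
  rw [← hu] at hcon
  have key : ∀ b, b < j → E P i' b → ∃ x y, R t i' ≤ x ∧ x < R t (i'+1) ∧ C t b ≤ y ∧
      y < C t (b+1) ∧ y ≤ g u ∧ M.entry x y = true := by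
    intro b hb e
    rcases em.hE i' b e with h | ⟨x, y, h1, h2, h3, h4, h5⟩
    · exact absurd h.1 hii
    · refine ⟨x, y, h1, h2, h3, h4, ?_, h5⟩
      by_contra hy
      have := strict_le em.hC (b+1) j (by omega) (by omega)
      exact hcon ⟨x, y, h1, h2, by omega, by omega, h5⟩
  obtain ⟨J1, J1a, J1b, J1c⟩ : ∃ J1, J1 ≤ j ∧ (∀ b, b < j → E P i' b → b < J1) ∧
      (∀ J, J1 = J + 1 → E P i' J) := by
    have hex : ∃ J, ∀ b, b < j → E P i' b → b < J := ⟨j, fun b hb _ => hb⟩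
    refine ⟨Nat.find hex, Nat.find_min' hex (fun b hb _ => hb), Nat.find_spec hex, ?_⟩
    intro J hJ
    have h1 := Nat.find_min hex (m := J) (by omega)
    push Not at h1
    obtain ⟨b, hb, e, hJb⟩ := h1
    have := Nat.find_spec hex b hb e
    have : b = J := by omega
    rwa [← this]
  have low : ∀ b, b < J1 → C t b ≤ g u := by
    intro b hb
    obtain ⟨x, y, _, _, h3, _, h5, _⟩ := key (J1 - 1) (by omega) (J1c (J1 - 1) (by omega))
    have := strict_le em.hC b (J1 - 1) (by omega) (by omega)
    omega
  have top : g (u + (2 * P.n + 2)) < C t j := by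
    have := F.g2 (u + (2 * P.n + 2)) (by omega)
    rwa [show u + (2 * P.n + 2) + 1 = t by omega] at this
  have ctj : ∀ b, j ≤ b → b ≤ P.n → g (u + (2 * P.n + 2)) < C t b := by
    intro b hb hb'
    have := strict_le em.hC j b hb (by omega)
    omega
  refine core hi hj (R := R t) (Cs := C t) (Ct := C t) (G := fun x => g (u + x)) (J1 := J1) (J2 := j)
    em.hR em.hm em.r1 em.r2 (by omega) le_rfl hj.le ?_ ?_ ?_ (fun b hb => em.hC b (by omega))
    low (fun b _ hb => em.hC b hb) (fun b hb hb' => ctj b hb.le hb') em.hn ?_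
  · intro x hx
    exact F.gs (u + x) (by omega)
  · have := ctj P.n hj.le le_rfl
    have := em.hn
    omega
  · intro x hx
    exact F.ge _ (by omega)
  · intro a b e
    by_cases hb : b < j
    · rcases htr a b e with h | h
      · subst h
        by_cases q : b + 1 < J1
        · right; left
          rcases em.hE a b e with h | ⟨x, y, h1, h2, h3, h4, h5⟩
          · omega
          · have := low (b+1) q
            exact ⟨by omega, x, y, h1, h2, h3, fun _ => h4, by dsimp only [Nat.add_zero]; omega, h5⟩
        · right; right; left
          exact ⟨hb, by omega, rfl⟩
      · subst h
        right; left
        obtain ⟨x, y, h1, h2, h3, h4, h5, h6⟩ := key b hb e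
        exact ⟨J1b b hb e, x, y, h1, h2, h3, fun _ => h4, h5, h6⟩
    · rcases em.hE a b e with h | ⟨x, y, h1, h2, h3, h4, h5⟩
      · exact Or.inl h
      · right; right; right; left
        have := ctj b (by omega) e.2.1.le
        exact ⟨by omega, x, y, h1, h2, fun _ => h3, h4, by omega, h5⟩

lemma two_rows (F : Fam P M i j r N R C g) {i' : ℕ} (hi' : i' < P.m) (hii : i' ≠ i) (hN : 0 < N) :
    ∃ S : ℕ → ℕ, (∀ a, a < P.m → S a < S (a+1)) ∧ S P.m ≤ M.m ∧ S i ≤ r ∧ r < S (i+1) ∧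
      ∀ t, t < N → Fit S (R t) i' := by
  have hi := F.e.1
  have hne : (Finset.range N).Nonempty := ⟨0, by simpa using hN⟩
  rcases lt_or_gt_of_ne hii with w | w
  · obtain ⟨t0, h0, hmax⟩ := Finset.exists_max_image (Finset.range N) (fun t => R t (i'+1)) hne
    have em := F.emb t0 (by simpa using h0)
    obtain ⟨A, h1, h2, h3, h4⟩ := up_aux w hi em.hR
    refine ⟨A, ?_, (h3 P.m hi').1.trans em.hm, by rw [h2]; exact em.r1,
      lt_of_lt_of_le em.r2 (h3 i w).2,
      fun t ht => h4 _ (F.emb t ht).hR (hmax t (by simpa using ht))⟩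
    intro a ha
    by_cases q : a < i
    · exact h1 a q
    · exact lt_of_le_of_lt (h3 a (by omega)).1 (lt_of_lt_of_le (em.hR a ha) (h3 a (by omega)).2)
  · obtain ⟨t0, h0, hmin⟩ := Finset.exists_min_image (Finset.range N) (fun t => R t i') hne
    have em := F.emb t0 (by simpa using h0)
    obtain ⟨B, h1, h2, h2', h3, h4⟩ := lo_aux (M := M) w hi' em.hR em.hm
    refine ⟨B, ?_, h2', (h3 i w).1.trans em.r1, by rw [h2]; exact em.r2,
      fun t ht => h4 _ (F.emb t ht).hR (F.emb t ht).hm (hmin t (by simpa using ht))⟩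
    intro a ha
    by_cases q : i < a
    · exact h1 a q ha
    · exact lt_of_le_of_lt (h3 a (by omega)).1 (lt_of_lt_of_le (em.hR a ha) (h3 a (by omega)).2)

lemma two_case (F : Fam P M i j r N R C g) (hN : P.n * (2 * P.n + 4) + 2 ≤ N) (htr : TR P i) :
    PartitionContains M P := by
  by_contra hM
  apply hM
  obtain ⟨i', hi', hii, htr⟩ := htr
  have hj := F.e.2.1
  obtain ⟨S, h1, h2, h3, h4, h5⟩ := two_rows F hi' hii (by omega)
  have gs := strict_le F.gs
  have up : ∀ b, b < P.n → (b + 1) * (2 * P.n + 4) ≤ P.n * (2 * P.n + 4) :=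
    fun b hb => Nat.mul_le_mul_right _ (by omega)
  have st : ∀ b, (b + 1) * (2 * P.n + 4) = b * (2 * P.n + 4) + 2 * P.n + 4 := fun b => by ring
  refine ⟨S, fun b => g (b * (2 * P.n + 4)), h1, ?_, h2, ?_, ?_⟩
  · intro b hb
    have := up b hb
    have := st b
    have := gs (b * (2 * P.n + 4)) ((b + 1) * (2 * P.n + 4)) (by omega) (by omega)
    dsimp only; omega
  · have := F.g2 (P.n * (2 * P.n + 4)) (by omega)
    have em := F.emb (P.n * (2 * P.n + 4) + 1) (by omega)
    have := strict_le em.hC j P.n hj.le le_rfl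
    have := em.hn
    dsimp only; omega
  · intro a b ha hb hab
    have u1 := up b hb
    have u2 := st b
    have u3 := gs (b * (2 * P.n + 4)) ((b + 1) * (2 * P.n + 4)) (by omega) (by omega)
    rcases htr a b ⟨ha, hb, hab⟩ with h | h
    · subst h
      exact ⟨r, g (b * (2 * P.n + 4)), h3, h4, le_rfl, by dsimp only; omega, F.ge _ (by omega)⟩
    · subst h
      obtain ⟨t, ht⟩ : ∃ t, t = b * (2 * P.n + 4) + (2 * P.n + 3) := ⟨_, rfl⟩
      obtain ⟨x, y, q1, q2, q3, q4, q5⟩ := two_claim F hii htr hM (t := t) (by omega) (by omega)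
      rw [show t - (2 * P.n + 3) = b * (2 * P.n + 4) by omega] at q3
      have := h5 t (by omega)
      have := this.1
      have := (h5 t (by omega)).2
      have := F.g1 t (by omega)
      have := (F.emb t (by omega)).hC j hj
      have := gs t ((b + 1) * (2 * P.n + 4)) (by omega) (by omega)
      exact ⟨x, y, by omega, by omega, by dsimp only; omega, by dsimp only; omega, q5⟩

lemma fam_pc (F : Fam P M i j r N R C g) (hQ : NoQ P) (hN : P.n * (2 * P.n + 4) + 2 ≤ N) :
    PartitionContains M P := by
  by_cases htr : TR P i
  · exact two_case F hN htr
  have hj := F.e.2.1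
  have hN' : 2 * P.n + 5 ≤ N := by
    have : 1 * (2 * P.n + 4) ≤ P.n * (2 * P.n + 4) := Nat.mul_le_mul_right _ (by omega)
    omega
  refine cases_lemma (Rs := R 0) (Cs := C 0) (Rt := R (2 * P.n + 3)) (Ct := C (2 * P.n + 3)) (G := g)
    ⟨F.e.1, hj, F.emb _ (by omega), F.emb _ (by omega), fun x hx => F.gs x (by omega),
      fun x hx => F.ge x (by omega), F.g1 0 (by omega), F.g2 (2 * P.n + 2) (by omega)⟩ hQ F.e htr

lemma emb_of {c : ℕ} (h : PartitionContains (setOne M r c) P) (hM : ¬ PartitionContains M P) :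
    ∃ i j, E P i j ∧ ∃ R C, Emb P M i j r R C ∧ C j ≤ c ∧ c < C (j+1) := by
  obtain ⟨R, C, hR, hC, hRm, hCn, hE⟩ := h
  by_contra hcon
  apply hM
  refine ⟨R, C, hR, hC, hRm, hCn, ?_⟩
  intro i j hi hj hij
  by_contra hno
  apply hcon
  have wit : ∀ a b, E P a b → (R a ≤ r ∧ r < R (a+1) ∧ C b ≤ c ∧ c < C (b+1)) ∨
      ∃ x y, R a ≤ x ∧ x < R (a+1) ∧ C b ≤ y ∧ y < C (b+1) ∧ M.entry x y = true := by
    intro a b e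
    obtain ⟨x, y, h1, h2, h3, h4, h5⟩ := hE a b e.1 e.2.1 e.2.2
    by_cases q : x = r ∧ y = c
    · obtain ⟨rfl, rfl⟩ := q
      exact Or.inl ⟨h1, h2, h3, h4⟩
    · simp only [setOne, if_neg q] at h5
      exact Or.inr ⟨x, y, h1, h2, h3, h4, h5⟩
  have w0 := (wit i j ⟨hi, hj, hij⟩).resolve_right hno
  refine ⟨i, j, ⟨hi, hj, hij⟩, R, C, ⟨hR, hC, hRm, hCn, w0.1, w0.2.1, ?_⟩, w0.2.2.1, w0.2.2.2⟩
  intro a b e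
  rcases wit a b e with w | w
  · left
    constructor
    · rcases lt_trichotomy a i with q | q | q
      · have := strict_le hR (a+1) i (by omega) (by omega); omega
      · exact q
      · have := strict_le hR (i+1) a (by omega) e.1.le; omega
    · rcases lt_trichotomy b j with q | q | q
      · have := strict_le hC (b+1) j (by omega) (by omega); omega
      · exact q
      · have := strict_le hC (j+1) b (by omega) e.2.1.le; omega
  · exact Or.inr w

lemma seq_pc (hQ : NoQ P) (hN : P.n * (2 * P.n + 4) + 2 ≤ N) (e : E P i j) (f : ℕ → ℕ)
    (hf : ∀ t, t < N → ∃ R C, Emb P M i j r R C ∧ C j ≤ f t ∧ f t < C (j+1))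
    (hg : ∀ t, t + 1 < N → ∃ g, f t < g ∧ g < f (t+1) ∧ M.entry r g = true) :
    PartitionContains M P := by
  classical
  by_contra hM
  choose! R C h1 h2 h3 using hf
  choose! g g1 g2 g3 using hg
  have full : ∀ t s, t < N → s + 1 < N → C t j ≤ g s → g s < C t (j+1) → False := by
    intro t s ht hs q1 q2
    have em := h1 t ht
    apply hM
    refine ⟨R t, C t, em.hR, em.hC, em.hm, em.hn, ?_⟩
    intro a b ha hb hab
    rcases em.hE a b ⟨ha, hb, hab⟩ with ⟨rfl, rfl⟩ | w
    · exact ⟨r, g s, em.r1, em.r2, q1, q2, g3 s hs⟩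
    · exact w
  refine hM (fam_pc (R := R) (C := C) (g := g) ⟨e, h1, ?_, ?_, g3⟩ hQ hN)
  · intro t ht
    by_contra hc
    have := h2 t (by omega)
    have := g1 t ht
    exact full t t (by omega) ht (by omega) (by omega)
  · intro t ht
    by_contra hc
    have := h3 (t+1) (by omega)
    have := g2 t ht
    exact full (t+1) t (by omega) ht (by omega) (by omega)

lemma bounded_pos (hm : 0 < P.m) (hn : 0 < P.n) (hQ : NoQ P) : RowBounded (Av P) := by
  classical
  obtain ⟨N, hN⟩ : ∃ N, N = P.n * (2 * P.n + 4) + 2 := ⟨_, rfl⟩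
  refine ⟨(P.m * P.n) * N, ?_⟩
  intro M hc r hr
  by_contra hlt
  push Not at hlt
  unfold rowRunCount at hlt
  have hM : ¬ PartitionContains M P := fun h => hc.1 (pc_im hm hn h)
  let S : Finset ℕ := (Finset.range M.n).filter
    (fun j => M.entry r j = false ∧ (j = 0 ∨ M.entry r (j - 1) = true))
  have hS : {j | j < M.n ∧ M.entry r j = false ∧ (j = 0 ∨ M.entry r (j - 1) = true)} = (S : Set ℕ) := by
    ext x; simp [S]
  rw [hS, Set.ncard_coe_finset] at hlt
  have hdata : ∀ c, c ∈ S → ∃ p : ℕ × ℕ, E P p.1 p.2 ∧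
      ∃ R C, Emb P M p.1 p.2 r R C ∧ C p.2 ≤ c ∧ c < C (p.2+1) := by
    intro c hcS
    simp only [S, Finset.mem_filter, Finset.mem_range] at hcS
    have h1 := hc.2 r c hr hcS.1 hcS.2.1
    have h2 : PartitionContains (setOne M r c) P := by
      by_contra h
      exact h1 (fun h' => h (im_pc h'))
    obtain ⟨i, j, e, w⟩ := emb_of h2 hM
    exact ⟨(i, j), e, w⟩
  choose! p hp1 hp2 using hdata
  have hcard : (Finset.range P.m ×ˢ Finset.range P.n).card * N < S.card := by
    simpa using hlt
  obtain ⟨⟨i, j⟩, hij, hfib⟩ := Finset.exists_lt_card_fiber_of_mul_lt_card_of_maps_to (f := p)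
    (fun c hcS => by
      have := hp1 c hcS
      simp only [Finset.mem_product, Finset.mem_range]
      exact ⟨this.1, this.2.1⟩) hcard
  let T := S.filter (fun x => p x = (i, j))
  have hT : N < T.card := hfib
  let em := T.orderEmbOfFin rfl
  let f : ℕ → ℕ := fun t => if h : t < T.card then em ⟨t, h⟩ else 0
  have fT : ∀ t, t < N → f t ∈ S ∧ p (f t) = (i, j) := by
    intro t ht
    have h : t < T.card := by omega
    have : f t ∈ T := by
      simp only [f, dif_pos h]
      exact Finset.orderEmbOfFin_mem T rfl _
    exact Finset.mem_filter.mp this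
  have fl : ∀ t, t + 1 < N → f t < f (t+1) := by
    intro t ht
    have h : t < T.card := by omega
    have h' : t + 1 < T.card := by omega
    simp only [f, dif_pos h, dif_pos h']
    apply em.strictMono
    simp
  have e0 : E P i j := by
    have := fT 0 (by omega)
    have h := hp1 _ this.1
    rw [this.2] at h; exact h
  refine hM (seq_pc (r := r) hQ hN.ge e0 f ?_ ?_)
  · intro t ht
    have := fT t ht
    have h := hp2 _ this.1
    rw [this.2] at h; exact h
  · intro t ht
    have q1 := (fT t (by omega)).1
    have q2 := (fT (t+1) ht).1
    simp only [S, Finset.mem_filter, Finset.mem_range] at q1 q2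
    have q3 := fl t ht
    have q4 := q2.2.2.resolve_left (by omega)
    refine ⟨f (t+1) - 1, ?_, by omega, q4⟩
    by_contra hcon
    have : f (t+1) - 1 = f t := by omega
    rw [this, q1.2.1] at q4
    exact absurd q4 (by simp)

lemma bounded_all (hQ : NoQ P) : RowBounded (Av P) := by
  by_cases h : 0 < P.m ∧ 0 < P.n
  · exact bounded_pos h.1 h.2 hQ
  · refine ⟨0, fun M hc r hr => ?_⟩
    have he : {j | j < M.n ∧ M.entry r j = false ∧ (j = 0 ∨ M.entry r (j - 1) = true)} = ∅ := by
      ext x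
      simp only [Set.mem_setOf_eq, Set.mem_empty_iff_false, iff_false]
      rintro ⟨h1, h2, -⟩
      have h3 := hc.2 r x hr h1 h2
      apply h3
      rintro ⟨M', q1, q2, q3, -⟩
      have := con_pos q1 (show 0 < (setOne M r x).m by simp only [setOne]; omega)
        (show 0 < (setOne M r x).n by simp only [setOne]; omega)
      omega
    unfold rowRunCount
    rw [he]; simp

theorem main (P : BMat) : RowBounded (Av P) ↔ (¬ IntervalMinor Q1 P ∧ ¬ IntervalMinor Q2 P ∧
    ¬ IntervalMinor Q3 P ∧ ¬ IntervalMinor Q4 P) := by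
  constructor
  · intro h
    exact ⟨fun q => unb1 q h, fun q => unb2 q h, fun q => unb3 q h, fun q => unb4 q h⟩
  · rintro ⟨h1, h2, h3, h4⟩
    exact bounded_all (noQ_of h1 h2 h3 h4)

end IM


/-- **Theorem (main).** For every binary pattern `P`, the class `Av(P)` is
row-bounded if and only if `P` contains none of `Q₁, Q₂, Q₃, Q₄` as an
interval minor. -/
theorem stmt_0 (P : BMat) :
    RowBounded (Av P) ↔
      (¬ IntervalMinor Q1 P ∧ ¬ IntervalMinor Q2 P ∧
       ¬ IntervalMinor Q3 P ∧ ¬ IntervalMinor Q4 P) := by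
  exact IM.main P
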